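/- arXiv:2201.02776 — 2 statements merged into one kernel-verified Lean document; each statement's English description precedes it below -/
import Mathlib

section
/- Let R be a finite-dimensional complex solvable Leibniz algebra with nilradical N, and let Q be a subspace with R = N ⊕ Q as vector spaces and dim Q = dim(N/N²). Then R is complete: its center is trivial and every derivation of R is an inner derivation (a right multiplication operator R_a : x ↦ [x,a] for some a ∈ R). -/
open Module Submodule

universe u v w

/-- A bilinear bracket on `L`. -/
abbrev Bil (L : Type u) [AddCommGroup L] [Module ℂ L] : Type u := L →ₗ[ℂ] L →ₗ[ℂ] L

variable {L : Type u} [AddCommGroup L] [Module ℂ L]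

/-- The (right) Leibniz identity. -/
def IsLeibniz (br : Bil L) : Prop :=
  ∀ x y z : L, br (br x y) z = br (br x z) y + br x (br y z)

/-- The span of all brackets `[S, T]`. -/
def bspan (br : Bil L) (S T : Submodule ℂ L) : Submodule ℂ L :=
  Submodule.span ℂ {z : L | ∃ x ∈ S, ∃ y ∈ T, z = br x y}

/-- `I` is a (two-sided) ideal of the subalgebra `S`. -/
def IsIdealIn (br : Bil L) (S I : Submodule ℂ L) : Prop :=
  I ≤ S ∧ ∀ x ∈ I, ∀ y ∈ S, br x y ∈ I ∧ br y x ∈ I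

/-- `I` is a (two-sided) ideal of the whole algebra. -/
abbrev IsIdeal (br : Bil L) (I : Submodule ℂ L) : Prop := IsIdealIn br ⊤ I

/-- Lower central series of the subalgebra `S`. -/
def lcs (br : Bil L) (S : Submodule ℂ L) : ℕ → Submodule ℂ L
  | 0 => S
  | n + 1 => bspan br (lcs br S n) S

/-- The subalgebra `S` is nilpotent. -/
def IsNilpotentSub (br : Bil L) (S : Submodule ℂ L) : Prop :=
  ∃ n, lcs br S n = ⊥

/-- Derived series of the subalgebra `S`. -/
def derS (br : Bil L) (S : Submodule ℂ L) : ℕ → Submodule ℂ L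
  | 0 => S
  | n + 1 => bspan br (derS br S n) (derS br S n)

/-- The subalgebra `S` is solvable. -/
def IsSolvableSub (br : Bil L) (S : Submodule ℂ L) : Prop :=
  ∃ m, derS br S m = ⊥

/-- `N` is the nilradical (maximal nilpotent ideal) of the subalgebra `S`. -/
def IsNilradicalIn (br : Bil L) (S N : Submodule ℂ L) : Prop :=
  IsIdealIn br S N ∧ IsNilpotentSub br N ∧
    ∀ I : Submodule ℂ L, IsIdealIn br S I → IsNilpotentSub br I → I ≤ N

/-- `N` is the nilradical of the whole algebra. -/
abbrev IsNilradical (br : Bil L) (N : Submodule ℂ L) : Prop := IsNilradicalIn br ⊤ N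

/-- `N² = [N, N]`. -/
abbrev sqr (br : Bil L) (N : Submodule ℂ L) : Submodule ℂ L := bspan br N N

/-- `dim (N / N²)`. -/
noncomputable def dimModSq (br : Bil L) (N : Submodule ℂ L) : ℕ :=
  finrank ℂ (↥N ⧸ (Submodule.comap N.subtype (sqr br N)))

/-- The subalgebra `S` splits as a direct sum of two nonzero ideals. -/
def IsSplitIn (br : Bil L) (S : Submodule ℂ L) : Prop :=
  ∃ A B : Submodule ℂ L, IsIdealIn br S A ∧ IsIdealIn br S B ∧
    A ≠ ⊥ ∧ B ≠ ⊥ ∧ A ⊓ B = ⊥ ∧ A ⊔ B = S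

/-- The subalgebra `S` is abelian. -/
def IsAbelianIn (br : Bil L) (S : Submodule ℂ L) : Prop :=
  ∀ x ∈ S, ∀ y ∈ S, br x y = 0

section Two
variable {L1 : Type v} {L2 : Type w} [AddCommGroup L1] [Module ℂ L1]
  [AddCommGroup L2] [Module ℂ L2]

/-- A bracket-preserving linear isomorphism between the subalgebra `S1` of `L1` and
the subalgebra `S2` of `L2`. -/
def SubAlgIso (br1 : Bil L1) (S1 : Submodule ℂ L1) (br2 : Bil L2) (S2 : Submodule ℂ L2) :
    Prop :=
  ∃ φ : S1 →ₗ[ℂ] L2, Function.Injective φ ∧ Set.range ⇑φ = (S2 : Set L2) ∧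
    ∀ x y z : S1, (z : L1) = br1 (x : L1) (y : L1) → φ z = br2 (φ x) (φ y)

/-- An isomorphism of the two algebras. -/
def AlgIso (br1 : Bil L1) (br2 : Bil L2) : Prop :=
  ∃ φ : L1 ≃ₗ[ℂ] L2, ∀ x y : L1, φ (br1 x y) = br2 (φ x) (φ y)

end Two


section LieFlag
attribute [local instance] LieRing.ofAssociativeRing

/-- The right multiplications, as a Lie subalgebra of `End L`. -/
def rightMul (br : Bil L) (hleib : IsLeibniz br) : LieSubalgebra ℂ (Module.End ℂ L) :=
  { LinearMap.range br.flip with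
    lie_mem' := by
      rintro _ _ ⟨x, rfl⟩ ⟨y, rfl⟩
      refine ⟨br y x, ?_⟩
      ext z
      have := hleib z y x
      simp [LieRing.of_associative_ring_bracket, this] }

lemma mem_rightMul (br : Bil L) (hleib : IsLeibniz br) (g : Module.End ℂ L) :
    g ∈ rightMul br hleib ↔ ∃ x, br.flip x = g := Iff.rfl

lemma br_mem_bspan (br : Bil L) {S T : Submodule ℂ L} {x y : L} (hx : x ∈ S) (hy : y ∈ T) :
    br x y ∈ bspan br S T := Submodule.subset_span ⟨x, hx, y, hy, rfl⟩

lemma bspan_le (br : Bil L) {S T U : Submodule ℂ L} (h : ∀ x ∈ S, ∀ y ∈ T, br x y ∈ U) :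
    bspan br S T ≤ U := by
  refine Submodule.span_le.2 ?_
  rintro _ ⟨x, hx, y, hy, rfl⟩
  exact h x hx y hy

lemma rightMul_derived (br : Bil L) (hleib : IsLeibniz br) (n : ℕ) :
    ∀ g ∈ LieAlgebra.derivedSeries ℂ (rightMul br hleib) n,
      ∃ x ∈ derS br ⊤ n, br.flip x = (g : Module.End ℂ L) := by
  induction n with
  | zero =>
    rintro ⟨g, x, rfl⟩ -
    exact ⟨x, by simp [derS], rfl⟩
  | succ n ih =>
    intro g hg
    rw [LieAlgebra.derivedSeries_def, LieAlgebra.derivedSeriesOfIdeal_succ,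
      ← LieSubmodule.mem_toSubmodule, LieSubmodule.lieIdeal_oper_eq_linear_span'] at hg
    induction hg using Submodule.span_induction with
    | mem g hg =>
      obtain ⟨a, ha, b, hb, rfl⟩ := hg
      obtain ⟨x, hx, hxa⟩ := ih a ha
      obtain ⟨y, hy, hyb⟩ := ih b hb
      refine ⟨br y x, br_mem_bspan br hy hx, ?_⟩
      rw [LieSubalgebra.coe_bracket, ← hxa, ← hyb]
      ext z
      have := hleib z y x
      simp [LieRing.of_associative_ring_bracket, this]
    | zero => exact ⟨0, zero_mem _, by simp⟩
    | add a b _ _ ha hb =>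
      obtain ⟨x, hx, hxa⟩ := ha
      obtain ⟨y, hy, hyb⟩ := hb
      exact ⟨x + y, add_mem hx hy, by simp [hxa, hyb]⟩
    | smul c a _ ha =>
      obtain ⟨x, hx, hxa⟩ := ha
      exact ⟨c • x, Submodule.smul_mem _ _ hx, by simp [hxa]⟩

lemma rightMul_solvable (br : Bil L) (hleib : IsLeibniz br) (hsolv : IsSolvableSub br ⊤) :
    LieAlgebra.IsSolvable (rightMul br hleib) := by
  obtain ⟨m, hm⟩ := hsolv
  rw [LieAlgebra.isSolvable_iff ℂ]
  refine ⟨m, ?_⟩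
  rw [eq_bot_iff]
  intro g hg
  obtain ⟨x, hx, hxg⟩ := rightMul_derived br hleib m g hg
  rw [hm, Submodule.mem_bot] at hx
  subst hx
  rw [LieSubmodule.mem_bot]
  exact Subtype.ext (by rw [← hxg]; simp)

lemma lie_step [FiniteDimensional ℂ L] (br : Bil L) (hleib : IsLeibniz br)
    (hsolv : IsSolvableSub br ⊤) (F : Submodule ℂ L) (hF : ∀ x, ∀ v ∈ F, br v x ∈ F)
    (hne : F ≠ ⊤) : ∃ v, v ∉ F ∧ ∀ x, ∃ c : ℂ, br v x - c • v ∈ F := by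
  have := rightMul_solvable br hleib hsolv
  let F' : LieSubmodule ℂ (rightMul br hleib) L :=
    { F with
      lie_mem := by
        rintro ⟨_, x, rfl⟩ v hv
        exact hF x v hv }
  have : Nontrivial (L ⧸ F') := Submodule.Quotient.nontrivial_iff.2 hne
  have : Module.Finite ℂ (L ⧸ F') := inferInstanceAs (Module.Finite ℂ (L ⧸ F))
  obtain ⟨χ, hχ⟩ := LieModule.exists_nontrivial_weightSpace_of_isSolvable ℂ
    (rightMul br hleib) (L ⧸ F')
  obtain ⟨⟨w, hw⟩, hw0⟩ := exists_ne (0 : LieModule.weightSpace (L ⧸ F') χ)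
  obtain ⟨v, rfl⟩ := LieSubmodule.Quotient.surjective_mk' F' w
  refine ⟨v, ?_, ?_⟩
  · intro hv
    apply hw0
    apply Subtype.ext
    exact (LieSubmodule.Quotient.mk_eq_zero' (N := F')).2 hv
  · intro x
    refine ⟨χ ⟨br.flip x, x, rfl⟩, ?_⟩
    rw [LieModule.mem_weightSpace] at hw
    have h := hw ⟨br.flip x, x, rfl⟩
    rw [← LieModuleHom.map_lie, ← map_smul, ← sub_eq_zero, ← map_sub] at h
    exact (LieSubmodule.Quotient.mk_eq_zero' (N := F')).1 h

end LieFlag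

/-- One step of the flag. -/
def FlagStep (br : Bil L) (F G : Submodule ℂ L) : Prop :=
  F ≤ G ∧ ∀ x, ∃ c : ℂ, ∀ v ∈ G, br v x - c • v ∈ F

lemma exists_flag [FiniteDimensional ℂ L] (br : Bil L) (hleib : IsLeibniz br)
    (hsolv : IsSolvableSub br ⊤) :
    ∃ (F : ℕ → Submodule ℂ L) (n : ℕ), F 0 = ⊥ ∧ F n = ⊤ ∧ (∀ i, FlagStep br (F i) (F (i + 1))) ∧
      ∀ i x, ∀ v ∈ F i, br v x ∈ F i := by
  let P := {F : Submodule ℂ L // ∀ x, ∀ v ∈ F, br v x ∈ F}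
  have step : ∀ F : P, ∃ G : P, FlagStep br F.1 G.1 ∧ (F.1 = ⊤ ∨ F.1 < G.1) := by
    rintro ⟨F, hF⟩
    by_cases hne : F = ⊤
    · exact ⟨⟨F, hF⟩, ⟨le_rfl, fun x => ⟨0, fun v hv => by simpa using hF x v hv⟩⟩, Or.inl hne⟩
    · obtain ⟨v, hv, h⟩ := lie_step br hleib hsolv F hF hne
      have key : ∀ x, ∃ c : ℂ, ∀ w ∈ F ⊔ ℂ ∙ v, br w x - c • w ∈ F := by
        intro x
        obtain ⟨c, hc⟩ := h x
        refine ⟨c, fun w hw => ?_⟩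
        obtain ⟨f, hf, w', hw', rfl⟩ := Submodule.mem_sup.1 hw
        obtain ⟨a, rfl⟩ := Submodule.mem_span_singleton.1 hw'
        have : br (f + a • v) x - c • (f + a • v) = br f x - c • f + a • (br v x - c • v) := by
          simp only [map_add, map_smul, LinearMap.add_apply, LinearMap.smul_apply]
          module
        rw [this]
        exact add_mem (sub_mem (hF x f hf) (F.smul_mem _ hf)) (F.smul_mem _ hc)
      refine ⟨⟨F ⊔ ℂ ∙ v, ?_⟩, ⟨le_sup_left, key⟩, Or.inr ?_⟩
      · intro x w hw
        obtain ⟨c, hc⟩ := key x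
        have := add_mem ((le_sup_left : F ≤ F ⊔ ℂ ∙ v) (hc w hw)) (Submodule.smul_mem _ c hw)
        simpa using this
      · refine lt_of_le_of_ne le_sup_left ?_
        intro heq
        apply hv
        have heq' : F = F ⊔ ℂ ∙ v := heq
        rw [heq']
        exact Submodule.mem_sup_right (Submodule.mem_span_singleton_self v)
  choose s hs hs' using step
  let F : ℕ → P := fun n => s^[n] ⟨⊥, by simp⟩
  have hFs : ∀ n, F (n + 1) = s (F n) := fun n => Function.iterate_succ_apply' _ _ _
  refine ⟨fun n => (F n).1, finrank ℂ L + 1, rfl, ?_, ?_, fun i => (F i).2⟩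
  · have : ∀ n, (F n).1 = ⊤ ∨ n ≤ finrank ℂ (F n).1 := by
      intro n
      induction n with
      | zero => right; simp
      | succ n ih =>
        rw [hFs]
        rcases hs' (F n) with h | h
        · left
          exact top_le_iff.1 (h ▸ (hs (F n)).1)
        · rcases ih with ih | ih
          · exact absurd (ih ▸ h) not_top_lt
          · right
            have := Submodule.finrank_lt_finrank_of_lt h
            omega
    rcases this (finrank ℂ L + 1) with h | h
    · exact h
    · have := Submodule.finrank_le (F (finrank ℂ L + 1)).1
      omega
  · intro i
    have := hs (F i)
    rwa [← hFs] at this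

/-- In a solvable Leibniz algebra, elements with nilpotent right multiplication, and all
brackets, lie in the nilradical. -/
lemma nilradical_props [FiniteDimensional ℂ L] (br : Bil L) (hleib : IsLeibniz br)
    (hsolv : IsSolvableSub br ⊤) (N : Submodule ℂ L) (hN : IsNilradical br N) :
    (∀ x y, br x y ∈ N) ∧ ∀ y, (∀ v, ∃ m : ℕ, ((br.flip y) ^ m) v = 0) → y ∈ N := by
  obtain ⟨F, n, h0, hn, hst, hinv⟩ := exists_flag br hleib hsolv
  let I : Submodule ℂ L :=
    { carrier := {y | ∀ i, ∀ v ∈ F (i + 1), br v y ∈ F i}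
      add_mem' := fun {a b} ha hb i v hv => by
        rw [map_add]; exact add_mem (ha i v hv) (hb i v hv)
      zero_mem' := fun i v hv => by simp
      smul_mem' := fun c a ha i v hv => by
        rw [map_smul]; exact Submodule.smul_mem _ _ (ha i v hv) }
  have hbr : ∀ x y, br x y ∈ I := by
    intro x y i v hv
    obtain ⟨c, hc⟩ := (hst i).2 x
    obtain ⟨e, he⟩ := (hst i).2 y
    have e1 : br v (br x y) = br (br v x) y - br (br v y) x := by
      rw [hleib v x y]; abel
    have e2 : br v (br x y) = br (br v x - c • v) y - br (br v y - e • v) x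
        + c • (br v y - e • v) - e • (br v x - c • v) := by
      rw [e1]
      simp only [map_sub, map_smul, LinearMap.sub_apply, LinearMap.smul_apply]
      module
    rw [e2]
    exact sub_mem (add_mem (sub_mem (hinv i y _ (hc v hv)) (hinv i x _ (he v hv)))
      (Submodule.smul_mem _ _ (he v hv))) (Submodule.smul_mem _ _ (hc v hv))
  have hI : I ≤ N := by
    apply hN.2.2 I
    · exact ⟨le_top, fun x _ y _ => ⟨hbr _ _, hbr _ _⟩⟩
    · refine ⟨n, ?_⟩
      have : ∀ j, j ≤ n → lcs br I j ≤ F (n - j) := by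
        intro j
        induction j with
        | zero => intro _; simp [hn]
        | succ j ih =>
          intro hj
          apply bspan_le
          intro x hx y hy
          apply hy
          have := ih (by omega) hx
          rwa [show n - (j + 1) + 1 = n - j by omega]
      have := this n le_rfl
      rw [Nat.sub_self, h0] at this
      exact le_bot_iff.1 this
  refine ⟨fun x y => hI (hbr x y), fun y hy => hI ?_⟩
  intro i v hv
  obtain ⟨c, hc⟩ := (hst i).2 y
  by_cases hc0 : c = 0
  · simpa [hc0] using hc v hv
  · have hpow : ∀ m : ℕ, ((br.flip y) ^ m) v - c ^ m • v ∈ F i := by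
      intro m
      induction m with
      | zero => simp
      | succ m ih =>
        have e : ((br.flip y) ^ (m + 1)) v - c ^ (m + 1) • v =
            br (((br.flip y) ^ m) v - c ^ m • v) y + c ^ m • (br v y - c • v) := by
          rw [pow_succ' (br.flip y)]
          simp only [Module.End.mul_apply, LinearMap.flip_apply, map_sub, map_smul,
            LinearMap.sub_apply, LinearMap.smul_apply]
          module
        rw [e]
        exact add_mem (hinv i y _ ih) (Submodule.smul_mem _ _ (hc v hv))
    obtain ⟨m, hm⟩ := hy v
    have h1 := hpow m
    rw [hm, zero_sub, neg_mem_iff, Submodule.smul_mem_iff _ (pow_ne_zero _ hc0)] at h1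
    exact hinv i y v h1

lemma maxGen_add {V : Type*} [AddCommGroup V] [Module ℂ V] {f g : Module.End ℂ V}
    (hc : Commute f g) {a b : ℂ} {v : V}
    (hf : v ∈ f.maxGenEigenspace a) (hg : v ∈ g.maxGenEigenspace b) :
    v ∈ (f + g).maxGenEigenspace (a + b) := by
  rw [Module.End.mem_maxGenEigenspace] at hf hg ⊢
  obtain ⟨k, hk⟩ := hf
  obtain ⟨l, hl⟩ := hg
  refine ⟨k + l, ?_⟩
  have hcom : Commute (f - a • (1 : Module.End ℂ V)) (g - b • (1 : Module.End ℂ V)) := by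
    refine ((hc.sub_left ?_).sub_right ?_)
    · exact (Commute.one_left _).smul_left _
    · exact (Commute.one_right _).smul_right _
  rw [show f + g - (a + b) • (1 : Module.End ℂ V)
    = (f - a • (1 : Module.End ℂ V)) + (g - b • (1 : Module.End ℂ V)) by module,
    hcom.add_pow', LinearMap.sum_apply]
  refine Finset.sum_eq_zero ?_
  rintro ⟨i, j⟩ hij
  rw [Finset.HasAntidiagonal.mem_antidiagonal] at hij
  simp only at hij ⊢
  rw [LinearMap.smul_apply]
  have : ((f - a • (1 : Module.End ℂ V)) ^ i * (g - b • (1 : Module.End ℂ V)) ^ j) v = 0 := by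
    rcases le_or_gt k i with h | h
    · rw [(hcom.pow_pow i j).eq, Module.End.mul_apply, ← Nat.sub_add_cancel h, pow_add,
        Module.End.mul_apply, hk]
      simp
    · rw [Module.End.mul_apply, ← Nat.sub_add_cancel (show l ≤ j by omega), pow_add,
        Module.End.mul_apply, hl]
      simp
  rw [this, smul_zero]

lemma maxGen_smul {V : Type*} [AddCommGroup V] [Module ℂ V] {f : Module.End ℂ V}
    {a c : ℂ} {v : V} (hf : v ∈ f.maxGenEigenspace a) :
    v ∈ (c • f).maxGenEigenspace (c * a) := by
  rw [Module.End.mem_maxGenEigenspace] at hf ⊢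
  obtain ⟨k, hk⟩ := hf
  refine ⟨k, ?_⟩
  rw [show c • f - (c * a) • (1 : Module.End ℂ V) = c • (f - a • (1 : Module.End ℂ V)) by module,
    smul_pow, LinearMap.smul_apply, hk, smul_zero]

lemma maxGen_unique {V : Type*} [AddCommGroup V] [Module ℂ V] {f : Module.End ℂ V}
    {a b : ℂ} {v : V} (hv : v ≠ 0) (ha : v ∈ f.maxGenEigenspace a)
    (hb : v ∈ f.maxGenEigenspace b) : a = b := by
  by_contra h
  exact hv (Submodule.disjoint_def.1 (Module.End.disjoint_genEigenspace f h ⊤ ⊤) v ha hb)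

/-- A commuting space of operators on `V`, of dimension `dim V` and without nonzero nilpotents,
is its own normalizer. -/
lemma self_normalizing {V P : Type*} [AddCommGroup V] [Module ℂ V] [FiniteDimensional ℂ V]
    [AddCommGroup P] [Module ℂ P] [FiniteDimensional ℂ P] (φ : P →ₗ[ℂ] Module.End ℂ V)
    (hcomm : ∀ x y, Commute (φ x) (φ y)) (hdim : finrank ℂ P = finrank ℂ V)
    (hnil : ∀ x, (∀ v, ∃ m : ℕ, (φ x ^ m) v = 0) → x = 0)
    (E : Module.End ℂ V) (hE : ∀ x, ∃ y, E * φ x - φ x * E = φ y) : ∃ a, φ a = E := by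
  classical
  let W : (P → ℂ) → Submodule ℂ V := fun χ => ⨅ x, (φ x).maxGenEigenspace (χ x)
  have hW : ∀ χ v, v ∈ W χ ↔ ∀ x, v ∈ (φ x).maxGenEigenspace (χ x) := by
    intro χ v; simp only [W, Submodule.mem_iInf]
  have hind : iSupIndep W :=
    Module.End.independent_iInf_maxGenEigenspace_of_forall_mapsTo (fun x => φ x)
      (fun i j c => Module.End.mapsTo_maxGenEigenspace_of_comm (hcomm j i) c)
  have htop : ⨆ χ, W χ = ⊤ :=
    Module.End.iSup_iInf_maxGenEigenspace_eq_top_of_iSup_maxGenEigenspace_eq_top_of_commute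
      (fun x => φ x) (fun i j _ => hcomm i j)
      (fun i => Module.End.iSup_maxGenEigenspace_eq_top _)
  let S := {χ : P → ℂ // W χ ≠ ⊥}
  let _ : Fintype S := hind.fintypeNeBotOfFiniteDimensional
  have hcard : Fintype.card S ≤ finrank ℂ V := hind.subtype_ne_bot_le_finrank
  have hex : ∀ χ : S, ∃ v ∈ W χ.1, v ≠ 0 := fun χ => (Submodule.ne_bot_iff _).1 χ.2
  choose v hvW hv0 using hex
  have hmaps : ∀ χ x, ∀ w ∈ W χ, φ x w ∈ W χ := by
    intro χ x w hw
    rw [hW] at hw ⊢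
    intro y
    exact Module.End.mapsTo_maxGenEigenspace_of_comm (hcomm y x) _ (hw y)
  let Ψ : P →ₗ[ℂ] (S → ℂ) :=
    { toFun := fun x χ => χ.1 x
      map_add' := by
        intro x y
        funext χ
        have h := (hW _ _).1 (hvW χ)
        refine maxGen_unique (hv0 χ) (h (x + y)) ?_
        rw [map_add]
        exact maxGen_add (hcomm x y) (h x) (h y)
      map_smul' := by
        intro c x
        funext χ
        have h := (hW _ _).1 (hvW χ)
        refine maxGen_unique (hv0 χ) (h (c • x)) ?_
        rw [map_smul]
        exact maxGen_smul (h x) }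
  have hΨinj : Function.Injective Ψ := by
    rw [← LinearMap.ker_eq_bot, LinearMap.ker_eq_bot']
    intro x hx
    apply hnil
    have : (φ x).maxGenEigenspace 0 = ⊤ := by
      rw [eq_top_iff, ← htop]
      refine iSup_le fun χ => ?_
      by_cases hχ : W χ = ⊥
      · rw [hχ]; exact bot_le
      · intro w hw
        have h := (hW _ _).1 hw x
        have : χ x = 0 := congrFun hx ⟨χ, hχ⟩
        rwa [this] at h
    intro w
    have hw : w ∈ (φ x).maxGenEigenspace 0 := this ▸ Submodule.mem_top
    rw [Module.End.mem_maxGenEigenspace] at hw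
    simpa using hw
  have hcard' : finrank ℂ P ≤ Fintype.card S := by
    have := LinearMap.finrank_le_finrank_of_injective hΨinj
    simpa using this
  have hcardeq : Fintype.card S = finrank ℂ V := by omega
  have hΨsurj : Function.Surjective Ψ := by
    rw [← LinearMap.injective_iff_surjective_of_finrank_eq_finrank]
    · exact hΨinj
    · simp; omega
  have hindS : iSupIndep (fun χ : S => W χ.1) := hind.comp Subtype.val_injective
  have hli : LinearIndependent ℂ v := hindS.linearIndependent _ hvW hv0
  have hspan : Submodule.span ℂ (Set.range v) = ⊤ := hli.span_eq_top_of_card_eq_finrank' hcardeq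
  have hone : ∀ χ : S, ∀ w ∈ W χ.1, ∃ c : ℂ, w = c • v χ := by
    intro χ w hw
    have hw' : w ∈ Submodule.span ℂ (Set.range v) := hspan ▸ Submodule.mem_top
    obtain ⟨c, hc⟩ := (Submodule.mem_span_range_iff_exists_fun ℂ).1 hw'
    refine ⟨c χ, ?_⟩
    have h := (iSupIndep_iff_finsetSum_eq_imp_eq _).1 hindS Finset.univ (fun i => c i • v i)
      (Pi.single χ w) ?_ ?_ χ (Finset.mem_univ _)
    · simpa using h.symm
    · intro i _
      refine ⟨Submodule.smul_mem _ _ (hvW i), ?_⟩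
      by_cases hi : i = χ
      · subst hi; simpa using hw
      · simp [hi]
    · rw [hc]; simp
  have hscal : ∀ χ : S, ∀ x, ∀ w ∈ W χ.1, φ x w = χ.1 x • w := by
    intro χ x
    obtain ⟨c, hc⟩ := hone χ _ (hmaps _ x _ (hvW χ))
    have hcχ : c = χ.1 x := by
      refine maxGen_unique (hv0 χ) ?_ ((hW _ _).1 (hvW χ) x)
      rw [Module.End.mem_maxGenEigenspace]
      exact ⟨1, by simp [hc]⟩
    intro w hw
    obtain ⟨e, rfl⟩ := hone χ w hw
    rw [map_smul, hc, hcχ, smul_comm]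
  have hEmaps : ∀ χ : S, E (v χ) ∈ W χ.1 := by
    intro χ
    rw [hW]
    intro x
    obtain ⟨y, hy⟩ := hE x
    have h1 := LinearMap.congr_fun hy (v χ)
    simp only [LinearMap.sub_apply, Module.End.mul_apply] at h1
    rw [hscal χ x _ (hvW χ), hscal χ y _ (hvW χ), map_smul] at h1
    rw [Module.End.mem_maxGenEigenspace]
    refine ⟨2, ?_⟩
    have h2 : (φ x - χ.1 x • (1 : Module.End ℂ V)) (E (v χ)) = -(χ.1 y • v χ) := by
      rw [← h1]; simp
    rw [pow_two, Module.End.mul_apply, h2]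
    simp [hscal χ x _ (hvW χ), smul_comm (χ.1 x)]
  have hl : ∀ χ : S, ∃ c : ℂ, E (v χ) = c • v χ := fun χ => hone χ _ (hEmaps χ)
  choose l hl using hl
  obtain ⟨a, ha⟩ := hΨsurj l
  refine ⟨a, ?_⟩
  refine LinearMap.ext_on_range hspan fun χ => ?_
  rw [hl, hscal χ a _ (hvW χ), ← congrFun ha χ]
  rfl

lemma lcs_le (br : Bil L) (N : Submodule ℂ L) (hsub : ∀ x ∈ N, ∀ y ∈ N, br x y ∈ N) (j : ℕ) :
    lcs br N (j + 1) ≤ lcs br N j := by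
  induction j with
  | zero => exact bspan_le br hsub
  | succ j ih =>
    exact bspan_le br fun x hx y hy => br_mem_bspan br (ih hx) hy

lemma lcs_br_sqr (br : Bil L) (hleib : IsLeibniz br) (N : Submodule ℂ L) (j : ℕ)
    {x w : L} (hx : x ∈ lcs br N j) (hw : w ∈ sqr br N) : br x w ∈ lcs br N (j + 2) := by
  have : sqr br N ≤ (lcs br N (j + 2)).comap (br x) := by
    refine bspan_le br fun b hb c hc => ?_
    rw [Submodule.mem_comap]
    have e1 : br x (br b c) = br (br x b) c - br (br x c) b := by
      rw [hleib x b c]; abel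
    rw [e1]
    exact sub_mem (br_mem_bspan br (br_mem_bspan br hx hb) hc)
      (br_mem_bspan br (br_mem_bspan br hx hc) hb)
  exact this hw

/-- A subalgebra of a nilpotent algebra `N` which spans `N` modulo `N²` is all of `N`. -/
lemma gen_lemma (br : Bil L) (hleib : IsLeibniz br) (N S : Submodule ℂ L)
    (hsub : ∀ x ∈ N, ∀ y ∈ N, br x y ∈ N) (hnil : IsNilpotentSub br N)
    (hS : ∀ x ∈ S, ∀ y ∈ S, br x y ∈ S) (hgen : N ≤ S ⊔ sqr br N) : N ≤ S := by
  have step : ∀ j, lcs br N j ≤ S ⊔ lcs br N (j + 1) := by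
    intro j
    induction j with
    | zero => exact hgen
    | succ j ih =>
      refine bspan_le br fun x hx y hy => ?_
      obtain ⟨s, hs, u, hu, rfl⟩ := Submodule.mem_sup.1 (ih hx)
      obtain ⟨t, ht, w, hw, rfl⟩ := Submodule.mem_sup.1 (hgen hy)
      have hs' : s ∈ lcs br N j := by
        have := sub_mem hx (lcs_le br N hsub j hu)
        simpa using this
      have e : br (s + u) (t + w) = br s t + (br s w + br u (t + w)) := by
        simp only [map_add, LinearMap.add_apply]; abel
      rw [e]
      exact add_mem (Submodule.mem_sup_left (hS s hs t ht))
        (Submodule.mem_sup_right (add_mem (lcs_br_sqr br hleib N j hs' hw)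
          (br_mem_bspan br hu hy)))
  have all : ∀ j, N ≤ S ⊔ lcs br N j := by
    intro j
    induction j with
    | zero => exact le_sup_right
    | succ j ih => exact ih.trans (sup_le le_sup_left (step j))
  obtain ⟨n, hn⟩ := hnil
  have := all n
  rwa [hn, sup_bot_eq] at this

lemma br_maxGen (br : Bil L) (D : Module.End ℂ L)
    (hD : ∀ x y, D (br x y) = br (D x) y + br x (D y)) {a b : ℂ} {u v : L}
    (hu : u ∈ D.maxGenEigenspace a) (hv : v ∈ D.maxGenEigenspace b) :
    br u v ∈ D.maxGenEigenspace (a + b) := by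
  rw [Module.End.mem_maxGenEigenspace] at hu hv ⊢
  obtain ⟨p, hp⟩ := hu
  obtain ⟨q, hq⟩ := hv
  have key : ∀ n p q : ℕ, p + q = n → ∀ u v, ((D - a • (1 : Module.End ℂ L)) ^ p) u = 0 →
      ((D - b • (1 : Module.End ℂ L)) ^ q) v = 0 →
      ((D - (a + b) • (1 : Module.End ℂ L)) ^ n) (br u v) = 0 := by
    intro n
    induction n with
    | zero =>
      intro p q h u v hu hv
      obtain rfl : p = 0 := by omega
      have : u = 0 := by simpa using hu
      simp [this]
    | succ n ih =>
      intro p q h u v hu hv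
      rcases p with _ | p
      · have : u = 0 := by simpa using hu
        simp [this]
      rcases q with _ | q
      · have : v = 0 := by simpa using hv
        simp [this]
      have e : (D - (a + b) • (1 : Module.End ℂ L)) (br u v) =
          br ((D - a • (1 : Module.End ℂ L)) u) v + br u ((D - b • (1 : Module.End ℂ L)) v) := by
        simp only [LinearMap.sub_apply, LinearMap.smul_apply, Module.End.one_apply, hD, map_sub,
          map_smul]
        module
      rw [pow_succ, Module.End.mul_apply, e, map_add,
        ih p (q + 1) (by omega) _ _ (by rw [← Module.End.mul_apply, ← pow_succ, hu]) hv,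
        ih (p + 1) q (by omega) _ _ hu (by rw [← Module.End.mul_apply, ← pow_succ, hv]), add_zero]
  exact ⟨p + q, key _ p q rfl u v hp hq⟩

lemma fitting_mod [FiniteDimensional ℂ L] (N M : Submodule ℂ L) (D : Module.End ℂ L)
    (hDN : ∀ x ∈ N, D x ∈ N) (a : ℂ) (m : ℕ)
    (h : ∀ x ∈ N, ((D - a • (1 : Module.End ℂ L)) ^ m) x ∈ M) :
    N ≤ (N ⊓ D.maxGenEigenspace a) ⊔ M := by
  have hf : ∀ x ∈ N, (D - a • (1 : Module.End ℂ L)) x ∈ N := fun x hx => by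
    simpa using sub_mem (hDN x hx) (N.smul_mem a hx)
  let f : Module.End ℂ N := (D - a • (1 : Module.End ℂ L)).restrict hf
  have hpow : ∀ (k : ℕ) (x : N), ((f ^ k) x : L) = ((D - a • (1 : Module.End ℂ L)) ^ k) x := by
    intro k
    induction k with
    | zero => intro x; simp
    | succ k ih =>
      intro x
      rw [pow_succ, pow_succ, Module.End.mul_apply, Module.End.mul_apply, ih]
      rfl
  intro x hx
  have hc := (f.isCompl_iSup_ker_pow_iInf_range_pow).sup_eq_top
  have hx' : (⟨x, hx⟩ : N) ∈ (⨆ n, LinearMap.ker (f ^ n)) ⊔ (⨅ n, LinearMap.range (f ^ n)) :=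
    hc ▸ Submodule.mem_top
  obtain ⟨p, hp, q, hq, hpq⟩ := Submodule.mem_sup.1 hx'
  have hx2 : x = p + q := by rw [← Submodule.coe_add, hpq]
  rw [hx2]
  refine add_mem (Submodule.mem_sup_left ⟨p.2, ?_⟩) (Submodule.mem_sup_right ?_)
  · have hle : (⨆ n, LinearMap.ker (f ^ n)) ≤ (D.maxGenEigenspace a).comap N.subtype := by
      refine iSup_le fun n y hy => ?_
      rw [Submodule.mem_comap, Module.End.mem_maxGenEigenspace]
      refine ⟨n, ?_⟩
      rw [Submodule.subtype_apply, ← hpow, LinearMap.mem_ker.1 hy]; rfl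
    exact hle hp
  · obtain ⟨y, hy⟩ := LinearMap.mem_range.1 ((Submodule.mem_iInf _).1 hq m)
    rw [← hy, hpow]
    exact h y y.2

lemma sqr_inv (br : Bil L) (N : Submodule ℂ L) (D : Module.End ℂ L)
    (hD : ∀ x y, D (br x y) = br (D x) y + br x (D y)) (hDN : ∀ x ∈ N, D x ∈ N) :
    ∀ x ∈ sqr br N, D x ∈ sqr br N := by
  have : sqr br N ≤ (sqr br N).comap D := by
    refine bspan_le br fun x hx y hy => ?_
    rw [Submodule.mem_comap, hD]
    exact add_mem (br_mem_bspan br (hDN x hx) hy) (br_mem_bspan br hx (hDN y hy))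
  exact this

/-- If `D` is a derivation acting as the identity on `N/N²`, then `N` and `N²` avoid
the generalized eigenvalues `0` and `1` respectively. -/
lemma grading [FiniteDimensional ℂ L] (br : Bil L) (hleib : IsLeibniz br) (N : Submodule ℂ L)
    (hsub : ∀ x ∈ N, ∀ y ∈ N, br x y ∈ N) (hnil : IsNilpotentSub br N) (D : Module.End ℂ L)
    (hD : ∀ x y, D (br x y) = br (D x) y + br x (D y)) (hDN : ∀ x ∈ N, D x ∈ N)
    (h1 : ∀ x ∈ N, D x - x ∈ sqr br N) :
    Disjoint N (D.maxGenEigenspace 0) ∧ Disjoint (sqr br N) (D.maxGenEigenspace 1) ∧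
      N ≤ (N ⊓ D.maxGenEigenspace 1) ⊔ sqr br N := by
  have hfit : N ≤ (N ⊓ D.maxGenEigenspace 1) ⊔ sqr br N :=
    fitting_mod N _ D hDN 1 1 (fun x hx => by simpa using h1 x hx)
  let W : ℕ → Submodule ℂ L := fun m => N ⊓ D.maxGenEigenspace (m : ℂ)
  have hWbr : ∀ m n, ∀ x ∈ W m, ∀ y ∈ W n, br x y ∈ W (m + n) := by
    rintro m n x ⟨hx, hx'⟩ y ⟨hy, hy'⟩
    refine ⟨hsub x hx y hy, ?_⟩
    push_cast
    exact br_maxGen br D hD hx' hy'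
  let S : Submodule ℂ L := ⨆ m : ℕ, W (m + 1)
  let U : Submodule ℂ L := ⨆ m : ℕ, W (m + 2)
  have hSS : ∀ x ∈ S, ∀ y ∈ S, br x y ∈ U := by
    rw [← Submodule.map₂_le, Submodule.map₂_iSup_left]
    refine iSup_le fun m => ?_
    rw [Submodule.map₂_iSup_right]
    refine iSup_le fun n => ?_
    rw [Submodule.map₂_le]
    intro x hx y hy
    have := hWbr _ _ x hx y hy
    rw [show m + 1 + (n + 1) = (m + n) + 2 by omega] at this
    exact (le_iSup (fun m : ℕ => W (m + 2)) (m + n)) this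
  have hUS : U ≤ S := iSup_le fun m => le_iSup (fun m : ℕ => W (m + 1)) (m + 1)
  have hNS : N ≤ S := by
    refine gen_lemma br hleib N S hsub hnil
      (fun x hx y hy => hUS (hSS x hx y hy)) (hfit.trans (sup_le_sup_right ?_ _))
    have := le_iSup (fun m : ℕ => W (m + 1)) 0
    simpa [W, S] using this
  have hN2 : sqr br N ≤ U := bspan_le br fun x hx y hy => hSS x (hNS hx) y (hNS hy)
  have hdis : ∀ a : ℂ, Disjoint (⨆ b, ⨆ (_ : b ≠ a), D.maxGenEigenspace b)
      (D.maxGenEigenspace a) := fun a => (D.independent_maxGenEigenspace a).symm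
  refine ⟨(hdis 0).mono_left (hNS.trans (iSup_le fun m => ?_)),
    (hdis 1).mono_left (hN2.trans (iSup_le fun m => ?_)), hfit⟩
  · refine inf_le_right.trans (le_iSup₂_of_le ((m + 1 : ℕ) : ℂ) ?_ le_rfl)
    exact_mod_cast Nat.succ_ne_zero m
  · refine inf_le_right.trans (le_iSup₂_of_le ((m + 2 : ℕ) : ℂ) ?_ le_rfl)
    exact_mod_cast (by omega : m + 2 ≠ 1)

/-- Right multiplication by `a`. -/
abbrev Rm (br : Bil L) (a : L) : Module.End ℂ L := br.flip a

/-- If right multiplication by `x` is nilpotent on `N / N²` then `x ∈ N`. -/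
lemma mem_of_nilpotent_mod [FiniteDimensional ℂ L]
    (br : Bil L) (hleib : IsLeibniz br) (hsolv : IsSolvableSub br (⊤ : Submodule ℂ L))
    (N : Submodule ℂ L) (hN : IsNilradical br N) (x : L) (m : ℕ)
    (hx : ∀ n ∈ N, ((Rm br x) ^ m) n ∈ sqr br N) : x ∈ N := by
  obtain ⟨hbr, hnilp⟩ := nilradical_props br hleib hsolv N hN
  have hgen : N ≤ (N ⊓ (Rm br x).maxGenEigenspace 0) ⊔ sqr br N := by
    refine fitting_mod N _ (Rm br x) (fun y _ => hbr y x) 0 m (fun n hn => ?_)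
    rw [zero_smul, sub_zero]
    exact hx n hn
  have hN0 : N ≤ N ⊓ (Rm br x).maxGenEigenspace 0 := by
    refine gen_lemma br hleib N _ (fun x _ y _ => hbr x y) hN.2.1 ?_ hgen
    rintro u ⟨_, hu⟩ v ⟨_, hv⟩
    refine ⟨hbr _ _, ?_⟩
    have := br_maxGen br (Rm br x) (fun y z => hleib y z x) hu hv
    rwa [add_zero] at this
  apply hnilp
  intro v
  have h1 : br v x ∈ (Rm br x).maxGenEigenspace 0 := (hN0 (hbr v x)).2
  rw [Module.End.mem_maxGenEigenspace] at h1
  obtain ⟨k, hk⟩ := h1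
  refine ⟨k + 1, ?_⟩
  rw [zero_smul, sub_zero] at hk
  rw [pow_succ, Module.End.mul_apply]
  exact hk

lemma uniform_nilpotent {V : Type*} [AddCommGroup V] [Module ℂ V] [FiniteDimensional ℂ V]
    (f : Module.End ℂ V) (h : ∀ v, ∃ m : ℕ, (f ^ m) v = 0) : ∃ m : ℕ, f ^ m = 0 := by
  refine ⟨finrank ℂ V, LinearMap.ext fun w => ?_⟩
  have hw : w ∈ f.maxGenEigenspace 0 := by
    rw [Module.End.mem_maxGenEigenspace]
    simpa using h w
  rw [Module.End.maxGenEigenspace_eq_genEigenspace_finrank, Module.End.mem_genEigenspace_nat,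
    LinearMap.mem_ker, zero_smul, sub_zero] at hw
  exact hw

/-- The endomorphism of `N / N²` induced by an endomorphism of `L`. -/
noncomputable def barEnd (N M : Submodule ℂ L) (f : Module.End ℂ L) (hN : ∀ x ∈ N, f x ∈ N)
    (hM : ∀ x ∈ M, f x ∈ M) : Module.End ℂ (↥N ⧸ Submodule.comap N.subtype M) :=
  Submodule.mapQ _ _ (f.restrict hN) (fun _ hx => hM _ hx)

lemma barEnd_mk (N M : Submodule ℂ L) (f : Module.End ℂ L) (hN : ∀ x ∈ N, f x ∈ N)
    (hM : ∀ x ∈ M, f x ∈ M) (x : N) :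
    barEnd N M f hN hM (Submodule.Quotient.mk x) = Submodule.Quotient.mk ⟨f x, hN x x.2⟩ := rfl

lemma bar_mk_eq (N M : Submodule ℂ L) (x y : N) :
    (Submodule.Quotient.mk x : ↥N ⧸ Submodule.comap N.subtype M) = Submodule.Quotient.mk y ↔
      (x : L) - y ∈ M := by
  rw [Submodule.Quotient.eq]; rfl

lemma barEnd_pow_mk (N M : Submodule ℂ L) (f : Module.End ℂ L) (hN : ∀ x ∈ N, f x ∈ N)
    (hM : ∀ x ∈ M, f x ∈ M) (m : ℕ) (x : N) :
    ∃ h : (f ^ m) (x : L) ∈ N, (barEnd N M f hN hM ^ m) (Submodule.Quotient.mk x) =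
      Submodule.Quotient.mk ⟨(f ^ m) (x : L), h⟩ := by
  induction m with
  | zero => exact ⟨x.2, rfl⟩
  | succ m ih =>
    obtain ⟨h, e⟩ := ih
    refine ⟨by rw [pow_succ', Module.End.mul_apply]; exact hN _ h, ?_⟩
    rw [pow_succ', Module.End.mul_apply, e, barEnd_mk]
    congr 2
    rw [pow_succ', Module.End.mul_apply]

/-- Operators on `N / N²` normalizing the right multiplications are right multiplications. -/
lemma exists_mult [FiniteDimensional ℂ L]
    (br : Bil L) (hleib : IsLeibniz br) (hsolv : IsSolvableSub br (⊤ : Submodule ℂ L))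
    (N Q : Submodule ℂ L) (hN : IsNilradical br N) (hQ : IsCompl N Q)
    (hdimQ : finrank ℂ Q = dimModSq br N) (E : Module.End ℂ L) (hEN : ∀ x ∈ N, E x ∈ N)
    (hEM : ∀ x ∈ sqr br N, E x ∈ sqr br N)
    (hE : ∀ x, ∃ y, ∀ n ∈ N, E (br n x) - br (E n) x - br n y ∈ sqr br N) :
    ∃ a, ∀ n ∈ N, E n - br n a ∈ sqr br N := by
  obtain ⟨hbr, -⟩ := nilradical_props br hleib hsolv N hN
  have hRN : ∀ a, ∀ x ∈ N, Rm br a x ∈ N := fun a x _ => hbr x a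
  have hRM : ∀ a, ∀ x ∈ sqr br N, Rm br a x ∈ sqr br N := fun a =>
    sqr_inv br N (Rm br a) (fun x y => hleib x y a) (hRN a)
  let φ : L →ₗ[ℂ] Module.End ℂ (↥N ⧸ Submodule.comap N.subtype (sqr br N)) :=
    { toFun := fun a => barEnd N (sqr br N) (Rm br a) (hRN a) (hRM a)
      map_add' := by
        intro a b
        refine LinearMap.ext fun w => ?_
        obtain ⟨x, rfl⟩ := Submodule.Quotient.mk_surjective _ w
        rw [LinearMap.add_apply, barEnd_mk, barEnd_mk, barEnd_mk, ← Submodule.Quotient.mk_add]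
        congr 1
        apply Subtype.ext
        simp
      map_smul' := by
        intro c b
        refine LinearMap.ext fun w => ?_
        obtain ⟨x, rfl⟩ := Submodule.Quotient.mk_surjective _ w
        rw [RingHom.id_apply, LinearMap.smul_apply, barEnd_mk, barEnd_mk,
          ← Submodule.Quotient.mk_smul]
        congr 1
        apply Subtype.ext
        simp }
  have hφ : ∀ a (x : N), φ a (Submodule.Quotient.mk x) =
      Submodule.Quotient.mk ⟨br x a, hbr _ _⟩ := fun a x => rfl
  have hφN : ∀ a ∈ N, φ a = 0 := by
    intro a ha
    refine LinearMap.ext fun w => ?_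
    obtain ⟨x, rfl⟩ := Submodule.Quotient.mk_surjective _ w
    rw [hφ, LinearMap.zero_apply, ← Submodule.Quotient.mk_zero, bar_mk_eq]
    simpa using br_mem_bspan br x.2 ha
  have hφc : ∀ a b, φ a * φ b - φ b * φ a = φ (br b a) := by
    intro a b
    refine LinearMap.ext fun w => ?_
    obtain ⟨x, rfl⟩ := Submodule.Quotient.mk_surjective _ w
    rw [LinearMap.sub_apply, Module.End.mul_apply, Module.End.mul_apply, hφ, hφ, hφ, hφ, hφ,
      ← Submodule.Quotient.mk_sub, bar_mk_eq]
    have := hleib x b a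
    simp [this]
  let Eb := barEnd N (sqr br N) E hEN hEM
  have hres := self_normalizing (φ.comp Q.subtype) ?_ hdimQ ?_ Eb ?_
  · obtain ⟨a, ha⟩ := hres
    refine ⟨a, fun n hn => ?_⟩
    have h := LinearMap.congr_fun ha (Submodule.Quotient.mk ⟨n, hn⟩)
    rw [LinearMap.comp_apply, Submodule.subtype_apply, hφ, barEnd_mk, bar_mk_eq] at h
    have := neg_mem h
    simpa using this
  · intro x y
    have := hφc x y
    rw [hφN _ (hbr _ _), sub_eq_zero] at this
    exact this
  · rintro ⟨x, hx⟩ h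
    obtain ⟨m, hm⟩ := uniform_nilpotent (φ x) h
    have hxN : x ∈ N := by
      refine mem_of_nilpotent_mod br hleib hsolv N hN x m (fun n hn => ?_)
      obtain ⟨h1, h2⟩ := barEnd_pow_mk N (sqr br N) (Rm br x) (hRN x) (hRM x) m ⟨n, hn⟩
      have h3 : (Submodule.Quotient.mk ⟨((Rm br x) ^ m) n, h1⟩ :
          ↥N ⧸ Submodule.comap N.subtype (sqr br N)) = 0 := by
        rw [← h2]
        exact LinearMap.congr_fun hm _
      rw [← Submodule.Quotient.mk_zero, bar_mk_eq] at h3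
      simpa using h3
    exact Subtype.ext (Submodule.disjoint_def.1 hQ.disjoint x hxN hx)
  · rintro ⟨x, hx⟩
    obtain ⟨y, hy⟩ := hE x
    have hy' : y ∈ N ⊔ Q := hQ.sup_eq_top ▸ Submodule.mem_top
    obtain ⟨n, hn, q, hq, rfl⟩ := Submodule.mem_sup.1 hy'
    refine ⟨⟨q, hq⟩, ?_⟩
    refine LinearMap.ext fun w => ?_
    obtain ⟨z, rfl⟩ := Submodule.Quotient.mk_surjective _ w
    have e : φ q = φ (n + q) := by rw [map_add, hφN n hn, zero_add]
    simp only [LinearMap.comp_apply, Submodule.subtype_apply]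
    rw [e, LinearMap.sub_apply, Module.End.mul_apply, Module.End.mul_apply, hφ, hφ, barEnd_mk,
      barEnd_mk, hφ, ← Submodule.Quotient.mk_sub, bar_mk_eq]
    exact hy z z.2


lemma hleib' (br : Bil L) (hleib : IsLeibniz br) (x b h : L) :
    br x (br b h) + br x (br h b) = 0 := by
  have h1 := hleib x b h
  have h2 := hleib x h b
  rw [h1] at h2
  have h3 : br (br x h) b + (br x (br b h) + br x (br h b)) = br (br x h) b := by
    rw [h2]; nth_rewrite 2 [h2]; abel
  simpa using h3

/-- A solvable Leibniz algebra `R = N ⊕ Q` with nilradical `N` and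
`dim Q = dim (N/N²)` is complete: its center is trivial and every derivation is a right
multiplication operator. -/
theorem stmt12 {L : Type u} [AddCommGroup L] [Module ℂ L] [FiniteDimensional ℂ L]
    (br : Bil L) (hleib : IsLeibniz br) (hsolv : IsSolvableSub br (⊤ : Submodule ℂ L))
    (N Q : Submodule ℂ L) (hN : IsNilradical br N) (hQ : IsCompl N Q)
    (hdimQ : finrank ℂ Q = dimModSq br N) :
    ({c : L | ∀ y : L, br c y = 0 ∧ br y c = 0} = {(0 : L)}) ∧
    (∀ d : L →ₗ[ℂ] L, (∀ x y : L, d (br x y) = br (d x) y + br x (d y)) →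
      ∃ a : L, ∀ x : L, d x = br x a) := by
  obtain ⟨hbr, -⟩ := nilradical_props br hleib hsolv N hN
  have hsub : ∀ x ∈ N, ∀ y ∈ N, br x y ∈ N := fun x _ y _ => hbr x y
  -- an element `h` acting as the identity on `N / N²`
  obtain ⟨h, hh⟩ := exists_mult br hleib hsolv N Q hN hQ hdimQ 1 (fun x hx => hx)
    (fun x hx => hx) (fun x => ⟨0, fun n _ => by simp⟩)
  have hD : ∀ a x y, Rm br a (br x y) = br (Rm br a x) y + br x (Rm br a y) :=
    fun a x y => hleib x y a
  obtain ⟨hdis0, hdis1, hfit⟩ := grading br hleib N hsub hN.2.1 (Rm br h) (hD h)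
    (fun x _ => hbr x h) (fun x hx => by simpa using neg_mem (hh x hx))
  have hinj : ∀ x ∈ N, br x h = 0 → x = 0 := by
    intro x hx hxh
    refine Submodule.disjoint_def.1 hdis0 x hx ?_
    rw [Module.End.mem_maxGenEigenspace]
    exact ⟨1, by simpa using hxh⟩
  have hsurj : ∀ x ∈ N, ∃ y ∈ N, br y h = x := by
    let f : N →ₗ[ℂ] N := (Rm br h).restrict (fun x _ => hbr x h)
    have hf : Function.Injective f := by
      rw [← LinearMap.ker_eq_bot, LinearMap.ker_eq_bot']
      intro x hx
      exact Subtype.ext (hinj x x.2 (congrArg Subtype.val hx))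
    intro x hx
    obtain ⟨y, hy⟩ := (LinearMap.injective_iff_surjective.1 hf) ⟨x, hx⟩
    exact ⟨y, y.2, congrArg Subtype.val hy⟩
  -- elements acting trivially on `N / N²` lie in `N`
  have hker : ∀ y, (∀ n ∈ N, br n y ∈ sqr br N) → y ∈ N := by
    intro y hy
    refine mem_of_nilpotent_mod br hleib hsolv N hN y 1 (fun n hn => ?_)
    rw [pow_one]
    exact hy n hn
  refine ⟨?_, ?_⟩
  · ext c
    simp only [Set.mem_setOf_eq, Set.mem_singleton_iff]
    constructor
    · intro hc
      refine hinj c (hker c fun n _ => ?_) (hc h).1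
      rw [(hc n).2]
      exact zero_mem _
    · rintro rfl y
      simp
  · intro d hd
    have hdN : ∀ x ∈ N, d x ∈ N := by
      intro x hx
      obtain ⟨y, _, rfl⟩ := hsurj x hx
      rw [hd]
      exact add_mem (hbr _ _) (hbr _ _)
    obtain ⟨a, ha⟩ := exists_mult br hleib hsolv N Q hN hQ hdimQ d hdN (sqr_inv br N d hd hdN)
      (fun x => ⟨d x, fun n _ => by rw [hd]; simp⟩)
    -- `d₁ = d - R_a` is zero on `N / N²` and maps everything to `N`
    have hd1N : ∀ x, d x - br x a ∈ N := by
      intro x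
      apply hker
      intro n hn
      have e : br n (d x - br x a) = (d (br n x) - br (br n x) a) - br (d n - br n a) x := by
        rw [hd, hleib n x a]
        simp only [map_sub, LinearMap.sub_apply]
        abel
      rw [e]
      exact sub_mem (ha _ (hbr n x)) (sqr_inv br N (Rm br x) (hD x) (fun z _ => hbr z x) _
        (ha n hn))
    obtain ⟨b, hbN, hb⟩ := hsurj _ (hd1N h)
    let δ : Module.End ℂ L := d - Rm br a + Rm br b
    have hδ : ∀ x, δ x = d x - br x a + br x b := fun x => rfl
    have hδder : ∀ x y, δ (br x y) = br (δ x) y + br x (δ y) := by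
      intro x y
      rw [hδ, hδ, hδ, hd, hleib x y a, hleib x y b]
      simp only [map_add, map_sub, LinearMap.sub_apply, LinearMap.add_apply]
      abel
    have hδN : ∀ x, δ x ∈ N := fun x => add_mem (hd1N x) (hbr _ _)
    have hδM : ∀ x ∈ N, δ x ∈ sqr br N := fun x hx =>
      add_mem (ha x hx) (br_mem_bspan br hx hbN)
    have hδh : ∀ x, δ (br x h) = br (δ x) h := by
      intro x
      rw [hδder, hδ h, ← hb, map_add, hleib' br hleib x b h]
      simp
    have hδcomm : Commute (Rm br h) δ := by
      refine LinearMap.ext fun x => ?_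
      exact (hδh x).symm
    have hδ1 : ∀ x ∈ N ⊓ (Rm br h).maxGenEigenspace 1, δ x = 0 := by
      rintro x ⟨hx, hx1⟩
      exact Submodule.disjoint_def.1 hdis1 _ (hδM x hx)
        (Module.End.mapsTo_maxGenEigenspace_of_comm hδcomm 1 hx1)
    have hNker : N ≤ LinearMap.ker δ := by
      refine gen_lemma br hleib N _ hsub hN.2.1 ?_ (hfit.trans (sup_le_sup_right ?_ _))
      · intro x hx y hy
        rw [LinearMap.mem_ker] at hx hy ⊢
        rw [hδder, hx, hy]
        simp
      · exact fun x hx => hδ1 x hx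
    have hδ0 : ∀ x, δ x = 0 := by
      intro x
      obtain ⟨y, hy, hyx⟩ := hsurj _ (hbr x h)
      have h1 : br (x - y) h = 0 := by rw [map_sub, LinearMap.sub_apply, hyx, sub_self]
      have h2 : δ (x - y) = 0 := by
        refine hinj _ (hδN _) ?_
        rw [← hδh, h1, map_zero]
      rw [map_sub, hNker hy, sub_zero] at h2
      exact h2
    refine ⟨a - b, fun x => ?_⟩
    have := hδ0 x
    rw [hδ] at this
    rw [map_sub, ← sub_eq_zero, ← this]
    abel
end

section
/- Let R be a finite-dimensional complex solvable Lie algebra with nilradical N, and let Q be a subspace with R = N ⊕ Q as vector spaces and dim Q = dim(N/[N,N]). Then R is complete: the center of R is trivial and every derivation of R equals ad x (the map y ↦ [y,x]) for some x ∈ R. -/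
open Module Submodule

universe u v w

variable {L : Type u} [AddCommGroup L] [Module ℂ L]

/-- The Lie ring structure attached to an antisymmetric Leibniz bracket. -/
abbrev lieRingOf {R : Type u} [AddCommGroup R] [Module ℂ R] (br : Bil R) (hleib : IsLeibniz br)
    (hanti : ∀ x y : R, br x y = - br y x) : LieRing R where
  bracket x y := br x y
  add_lie x y z := by change br (x + y) z = br x z + br y z; simp
  lie_add x y z := by change br x (y + z) = br x y + br x z; simp
  lie_self x := by
    change br x x = 0
    have h := hanti x x
    have h2 : (2 : ℂ) • br x x = 0 := by
      rw [two_smul]; nth_rewrite 1 [h]; simp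
    simpa using h2
  leibniz_lie x y z := by
    change br x (br y z) = br (br x y) z + br y (br x z)
    rw [hleib x y z, hanti (br x z) y]; abel

/-- The Lie algebra structure attached to an antisymmetric Leibniz bracket. -/
abbrev lieAlgebraOf {R : Type u} [AddCommGroup R] [Module ℂ R] (br : Bil R) (hleib : IsLeibniz br)
    (hanti : ∀ x y : R, br x y = - br y x) :
    @LieAlgebra ℂ R _ (lieRingOf br hleib hanti) :=
  letI := lieRingOf br hleib hanti
  { toModule := ‹Module ℂ R›
    lie_smul := fun t x y => by change br x (t • y) = t • br x y; simp }

lemma solvable_of {R : Type u} [AddCommGroup R] [Module ℂ R] (br : Bil R) (hleib : IsLeibniz br)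
    (hanti : ∀ x y : R, br x y = - br y x)
    (hsolv : IsSolvableSub br (⊤ : Submodule ℂ R)) :
    @LieAlgebra.IsSolvable R (lieRingOf br hleib hanti) := by
  letI := lieRingOf br hleib hanti
  letI := lieAlgebraOf br hleib hanti
  obtain ⟨m, hm⟩ := hsolv
  have key : ∀ n, ∀ z ∈ LieAlgebra.derivedSeries ℂ R n, z ∈ derS br (⊤ : Submodule ℂ R) n := by
    intro n
    induction n with
    | zero => intro z _; exact Submodule.mem_top
    | succ n ih =>
      intro z hz
      rw [LieAlgebra.derivedSeries_def, LieAlgebra.derivedSeriesOfIdeal_succ,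
        ← LieSubmodule.mem_toSubmodule, LieSubmodule.lieIdeal_oper_eq_linear_span'] at hz
      refine Submodule.span_mono ?_ hz
      rintro _ ⟨x, hx, y, hy, rfl⟩
      exact ⟨x, ih x hx, y, ih y hy, rfl⟩
  refine LieAlgebra.IsSolvable.mk (R := ℂ) (k := m) ?_
  rw [eq_bot_iff]
  intro z hz
  have := key m z hz
  rw [hm] at this
  simpa using this

/-- Engel: an ideal of ad-nilpotent elements is nilpotent. -/
lemma engel_of {R : Type u} [AddCommGroup R] [Module ℂ R] [FiniteDimensional ℂ R]
    (br : Bil R) (hleib : IsLeibniz br)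
    (hanti : ∀ x y : R, br x y = - br y x) (I : Submodule ℂ R) (hI : IsIdeal br I)
    (hnil : ∀ x ∈ I, IsNilpotent (br x : Module.End ℂ R)) : IsNilpotentSub br I := by
  letI := lieRingOf br hleib hanti
  letI := lieAlgebraOf br hleib hanti
  let J : LieSubalgebra ℂ R :=
    { I with lie_mem' := fun {x y} hx _ => (hI.2 x hx y Submodule.mem_top).1 }
  have h1 : LieModule.IsNilpotent J R := by
    rw [LieModule.isNilpotent_iff_forall' (R := ℂ)]
    intro x
    exact hnil x.1 x.2
  obtain ⟨k, hk⟩ := (LieModule.isNilpotent_iff ℂ J R).1 h1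
  have key : ∀ n, ∀ z ∈ lcs br I n, z ∈ LieModule.lowerCentralSeries ℂ J R n := by
    intro n
    induction n with
    | zero => intro z _; simp
    | succ n ih =>
      intro z hz
      rw [LieModule.lowerCentralSeries_succ, ← LieSubmodule.mem_toSubmodule]
      refine (Submodule.span_le.2 ?_ : lcs br I (n+1) ≤ _) hz
      rintro _ ⟨x, hx, y, hy, rfl⟩
      rw [hanti]
      refine Submodule.neg_mem _ ?_
      exact LieSubmodule.lie_mem_lie (LieSubmodule.mem_top (⟨y, hy⟩ : J)) (ih x hx)
  refine ⟨k, ?_⟩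
  rw [eq_bot_iff]
  intro z hz
  have := key k z hz
  rw [hk] at this
  simpa using this

/-- Theorem of Lie: a common eigenvector. -/
lemma common_eigvec {R : Type u} [AddCommGroup R] [Module ℂ R]
    (br : Bil R) (hleib : IsLeibniz br)
    (hanti : ∀ x y : R, br x y = - br y x)
    (hsolv : IsSolvableSub br (⊤ : Submodule ℂ R))
    {V : Type v} [AddCommGroup V] [Module ℂ V] [FiniteDimensional ℂ V] [Nontrivial V]
    (ρ : R →ₗ[ℂ] Module.End ℂ V)
    (hρ : ∀ x y v, ρ (br x y) v = ρ x (ρ y v) - ρ y (ρ x v)) :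
    ∃ (χ : R →ₗ[ℂ] ℂ) (v : V), v ≠ 0 ∧ ∀ r, ρ r v = χ r • v := by
  letI := lieRingOf br hleib hanti
  letI := lieAlgebraOf br hleib hanti
  haveI := solvable_of br hleib hanti hsolv
  letI : LieRingModule R V :=
    { bracket := fun x v => ρ x v
      add_lie := fun x y v => by change ρ (x + y) v = ρ x v + ρ y v; simp
      lie_add := fun x v w => by change ρ x (v + w) = ρ x v + ρ x w; simp
      leibniz_lie := fun x y v => by
        change ρ x (ρ y v) = ρ (br x y) v + ρ y (ρ x v)
        rw [hρ]; abel }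
  haveI : LieModule ℂ R V :=
    { smul_lie := fun t x v => by change ρ (t • x) v = t • ρ x v; simp
      lie_smul := fun t x v => by change ρ x (t • v) = t • ρ x v; simp }
  obtain ⟨χ, hχ⟩ := LieModule.exists_nontrivial_weightSpace_of_isSolvable ℂ R V
  obtain ⟨⟨v, hv⟩, hv0⟩ := exists_ne (0 : LieModule.weightSpace V χ)
  rw [LieModule.mem_weightSpace] at hv
  exact ⟨χ, v, fun h => hv0 (Subtype.ext h), hv⟩

/-- Simultaneous triangularisation, in terms of eigenvalues. -/
lemma weights_exist {R : Type u} [AddCommGroup R] [Module ℂ R]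
    (br : Bil R) (hleib : IsLeibniz br)
    (hanti : ∀ x y : R, br x y = - br y x)
    (hsolv : IsSolvableSub br (⊤ : Submodule ℂ R)) (k : ℕ) :
    ∀ (V : Type v) [AddCommGroup V] [Module ℂ V] [FiniteDimensional ℂ V]
    (_ : finrank ℂ V = k)
    (ρ : R →ₗ[ℂ] Module.End ℂ V)
    (_ : ∀ x y v, ρ (br x y) v = ρ x (ρ y v) - ρ y (ρ x v)),
    ∃ α : Fin k → (R →ₗ[ℂ] ℂ), (∀ i x y, α i (br x y) = 0) ∧
      ∀ r μ, Module.End.HasEigenvalue (ρ r) μ ↔ ∃ i, α i r = μ := by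
  induction k with
  | zero =>
    intro V _ _ _ hk ρ hρ
    refine ⟨fun i => 0, fun i => i.elim0, fun r μ => ⟨fun h => ?_, fun ⟨i, _⟩ => i.elim0⟩⟩
    obtain ⟨v, hv⟩ := h.exists_hasEigenvector
    haveI := finrank_zero_iff.1 hk
    exact absurd (Subsingleton.elim v 0) hv.2
  | succ k ih =>
    intro V _ _ _ hk ρ hρ
    haveI : Nontrivial V := nontrivial_of_finrank_pos (R := ℂ) (by omega)
    obtain ⟨χ, v, hv0, hv⟩ := common_eigvec br hleib hanti hsolv ρ hρ
    have hst : ∀ r, (ℂ ∙ v) ≤ (ℂ ∙ v).comap (ρ r) := by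
      intro r
      rw [Submodule.span_singleton_le_iff_mem, Submodule.mem_comap, hv]
      exact Submodule.smul_mem _ _ (Submodule.mem_span_singleton_self v)
    let ρ' : R →ₗ[ℂ] Module.End ℂ (V ⧸ (ℂ ∙ v)) :=
      { toFun := fun r => (ℂ ∙ v).mapQ (ℂ ∙ v) (ρ r) (hst r)
        map_add' := fun x y => by ext w; simp
        map_smul' := fun t x => by ext w; simp }
    have hρ'a : ∀ r w, ρ' r (Submodule.Quotient.mk w) = Submodule.Quotient.mk (ρ r w) :=
      fun r w => rfl
    have hk' : finrank ℂ (V ⧸ (ℂ ∙ v)) = k := by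
      have := (ℂ ∙ v).finrank_quotient_add_finrank
      rw [finrank_span_singleton hv0] at this
      omega
    obtain ⟨α, hα, hα2⟩ := ih (V ⧸ (ℂ ∙ v)) hk' ρ' (by
      intro x y w
      obtain ⟨w, rfl⟩ := Submodule.Quotient.mk_surjective _ w
      simp only [hρ'a, hρ, Submodule.Quotient.mk_sub])
    refine ⟨Fin.cons χ α, ?_, ?_⟩
    · intro i x y
      refine Fin.cases ?_ (fun i => ?_) i
      · have h := hρ x y v
        simp only [hv, map_smul] at h
        rw [smul_comm, sub_self, smul_eq_zero] at h
        simpa using h.resolve_right hv0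
      · simpa using hα i x y
    · intro r μ
      rw [Fin.exists_fin_succ]
      simp only [Fin.cons_zero, Fin.cons_succ, ← hα2]
      constructor
      · intro h
        obtain ⟨w, hw⟩ := h.exists_hasEigenvector
        by_cases hwv : w ∈ (ℂ ∙ v)
        · left
          obtain ⟨c, rfl⟩ := Submodule.mem_span_singleton.1 hwv
          have := hw.apply_eq_smul
          rw [map_smul, hv, smul_comm] at this
          exact smul_left_injective ℂ hw.2 this
        · right
          refine Module.End.hasEigenvalue_of_hasEigenvector (x := Submodule.Quotient.mk w) ?_
          refine Module.End.hasEigenvector_iff.2 ⟨?_, ?_⟩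
          · rw [Module.End.mem_eigenspace_iff, hρ'a, hw.apply_eq_smul, Submodule.Quotient.mk_smul]
          · rwa [Ne, Submodule.Quotient.mk_eq_zero]
      · rintro (h | h)
        · subst h
          exact Module.End.hasEigenvalue_of_hasEigenvector
            (Module.End.hasEigenvector_iff.2 ⟨Module.End.mem_eigenspace_iff.2 (hv r), hv0⟩)
        · by_contra hcon
          rw [Module.End.hasEigenvalue_iff, not_not, Module.End.eigenspace_def] at hcon
          have hs := LinearMap.surjective_of_injective (LinearMap.ker_eq_bot.1 hcon)
          have hs' : Function.Surjective (ρ' r - algebraMap ℂ (Module.End ℂ (V ⧸ (ℂ ∙ v))) μ) := by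
            intro w
            obtain ⟨w, rfl⟩ := Submodule.Quotient.mk_surjective _ w
            obtain ⟨u, rfl⟩ := hs w
            exact ⟨Submodule.Quotient.mk u, rfl⟩
          have hi := LinearMap.injective_iff_surjective.2 hs'
          rw [Module.End.hasEigenvalue_iff, Module.End.eigenspace_def] at h
          exact h (LinearMap.ker_eq_bot.2 hi)

lemma nilp_of_eig {V : Type v} [AddCommGroup V] [Module ℂ V] [FiniteDimensional ℂ V]
    (f : Module.End ℂ V) (h : ∀ μ, f.HasEigenvalue μ → μ = 0) : IsNilpotent f := by
  have h1 := Module.End.iSup_maxGenEigenspace_eq_top f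
  have h2 : f.maxGenEigenspace 0 = ⊤ := by
    rw [eq_top_iff, ← h1]
    refine iSup_le fun μ => ?_
    by_cases hμ : μ = 0
    · subst hμ; exact le_rfl
    · have : f.maxGenEigenspace μ = ⊥ := by
        by_contra hne
        refine hμ (h μ ?_)
        exact Module.End.HasUnifEigenvalue.lt (k := ⊤) (by simp) hne
      rw [this]; exact bot_le
  rw [Module.End.maxGenEigenspace_eq_genEigenspace_finrank, Module.End.genEigenspace_nat] at h2
  refine ⟨finrank ℂ V, ?_⟩
  rw [LinearMap.ker_eq_top] at h2
  simpa using h2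

section Core
variable {R : Type u} [AddCommGroup R] [Module ℂ R]

lemma jac_of (br : Bil R) (hleib : IsLeibniz br) (hanti : ∀ x y : R, br x y = - br y x)
    (x y z : R) : br x (br y z) = br (br x y) z + br y (br x z) := by
  rw [hleib x y z, hanti (br x z) y]; abel

lemma lcs_br (br : Bil R) (N : Submodule ℂ R) (m : ℕ) {a b : R} (ha : a ∈ lcs br N m)
    (hb : b ∈ N) : br a b ∈ lcs br N (m + 1) :=
  Submodule.subset_span ⟨a, ha, b, hb, rfl⟩

lemma lcs_stable (br : Bil R) (hleib : IsLeibniz br) (hanti : ∀ x y : R, br x y = - br y x)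
    (N : Submodule ℂ R) (hN : IsIdeal br N) (r : R) (m : ℕ) :
    ∀ a ∈ lcs br N m, br r a ∈ lcs br N m := by
  induction m with
  | zero => intro a ha; exact (hN.2 a ha r Submodule.mem_top).2
  | succ m ih =>
    intro a ha
    refine (Submodule.span_le.2 ?_ : lcs br N (m+1) ≤ (lcs br N (m+1)).comap (br r)) ha
    rintro _ ⟨a, ha, b, hb, rfl⟩
    simp only [Submodule.comap_coe, Set.mem_preimage, SetLike.mem_coe]
    rw [jac_of br hleib hanti]
    exact Submodule.add_mem _ (lcs_br br N m (ih a ha) hb)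
      (lcs_br br N m ha (hN.2 b hb r Submodule.mem_top).2)

lemma lcs_anti (br : Bil R) (hleib : IsLeibniz br) (hanti : ∀ x y : R, br x y = - br y x)
    (N : Submodule ℂ R) (hN : IsIdeal br N) (m : ℕ) : lcs br N (m + 1) ≤ lcs br N m := by
  refine Submodule.span_le.2 ?_
  rintro _ ⟨a, ha, b, hb, rfl⟩
  rw [hanti]
  exact Submodule.neg_mem _ (lcs_stable br hleib hanti N hN b m a ha)

lemma lcs_le_s13 (br : Bil R) (hleib : IsLeibniz br) (hanti : ∀ x y : R, br x y = - br y x)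
    (N : Submodule ℂ R) (hN : IsIdeal br N) (m : ℕ) : lcs br N m ≤ N := by
  induction m with
  | zero => exact le_rfl
  | succ m ih => exact (lcs_anti br hleib hanti N hN m).trans ih

lemma lcs_br2 (br : Bil R) (hleib : IsLeibniz br)
    (N : Submodule ℂ R) (m : ℕ) {a w : R}
    (ha : a ∈ lcs br N m) (hw : w ∈ lcs br N 1) : br a w ∈ lcs br N (m + 2) := by
  refine (Submodule.span_le.2 ?_ : lcs br N 1 ≤ (lcs br N (m+2)).comap (br a)) hw
  rintro _ ⟨b, hb, c, hc, rfl⟩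
  simp only [Submodule.comap_coe, Set.mem_preimage, SetLike.mem_coe]
  have : br a (br b c) = br (br a b) c - br (br a c) b := by rw [hleib a b c]; abel
  rw [this]
  exact Submodule.sub_mem _ (lcs_br br N (m+1) (lcs_br br N m ha hb) hc)
    (lcs_br br N (m+1) (lcs_br br N m ha hc) hb)

lemma gen_of (br : Bil R) (hleib : IsLeibniz br) (hanti : ∀ x y : R, br x y = - br y x)
    (N : Submodule ℂ R) (hN : IsIdeal br N) (hnil : IsNilpotentSub br N)
    (S : Submodule ℂ R) (hS : ∀ x ∈ S, ∀ y ∈ S, br x y ∈ S)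
    (hE : ∀ n ∈ N, ∃ e ∈ S, e ∈ N ∧ n - e ∈ lcs br N 1) : N ≤ S := by
  have key : ∀ m, lcs br N m ≤ S ⊔ lcs br N (m + 1) := by
    intro m
    induction m with
    | zero =>
      intro n hn
      obtain ⟨e, he, _, h⟩ := hE n hn
      exact Submodule.mem_sup.2 ⟨e, he, n - e, h, by abel⟩
    | succ m ih =>
      refine Submodule.span_le.2 ?_
      rintro _ ⟨a, ha, b, hb, rfl⟩
      obtain ⟨s, hs, u, hu, rfl⟩ := Submodule.mem_sup.1 (ih ha)
      obtain ⟨e, he, heN, h⟩ := hE b hb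
      have hs' : s ∈ lcs br N m := by
        have := Submodule.sub_mem _ ha (lcs_anti br hleib hanti N hN m hu)
        simpa using this
      refine Submodule.mem_sup.2 ⟨br s e, hS s hs e he, br s (b - e) + br u b, ?_, ?_⟩
      · exact Submodule.add_mem _ (lcs_br2 br hleib N m hs' h) (lcs_br br N (m+1) hu hb)
      · simp only [map_sub, map_add, LinearMap.add_apply]; abel
  have key2 : ∀ m, N ≤ S ⊔ lcs br N m := by
    intro m
    induction m with
    | zero => exact le_sup_right
    | succ m ih => exact ih.trans (sup_le le_sup_left (key m))
  obtain ⟨k, hk⟩ := hnil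
  have := key2 k
  rwa [hk, sup_bot_eq] at this

lemma eig_step (br : Bil R) (hleib : IsLeibniz br) (hanti : ∀ x y : R, br x y = - br y x)
    (N : Submodule ℂ R) (x : R)
    (hx : ∀ n ∈ N, br x n - n ∈ lcs br N 1) (m : ℕ) :
    ∀ a ∈ lcs br N m, br x a - ((m : ℂ) + 1) • a ∈ lcs br N (m + 1) := by
  induction m with
  | zero => intro a ha; simpa using hx a ha
  | succ m ih =>
    intro a ha
    let T : R →ₗ[ℂ] R := br x - (((m + 1 : ℕ) : ℂ) + 1) • LinearMap.id
    refine (Submodule.span_le.2 ?_ : lcs br N (m+1) ≤ (lcs br N (m+2)).comap T) ha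
    rintro _ ⟨a, ha, b, hb, rfl⟩
    simp only [Submodule.comap_coe, Set.mem_preimage, SetLike.mem_coe]
    have : T (br a b) = br (br x a - ((m : ℂ) + 1) • a) b + br a (br x b - b) := by
      simp only [T, LinearMap.sub_apply, LinearMap.smul_apply, LinearMap.id_apply, map_sub,
        map_smul, jac_of br hleib hanti x a b]
      push_cast
      module
    rw [this]
    exact Submodule.add_mem _ (lcs_br br N (m+1) (ih a ha) hb) (lcs_br2 br hleib N m ha (hx b hb))

lemma eig_zero (br : Bil R) (hleib : IsLeibniz br) (hanti : ∀ x y : R, br x y = - br y x)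
    (N : Submodule ℂ R) (hnil : IsNilpotentSub br N) (hN : IsIdeal br N) (x : R)
    (hx : ∀ n ∈ N, br x n - n ∈ lcs br N 1) (m : ℕ) (a : R) (ha : a ∈ lcs br N m) (c : ℕ)
    (hc : c ≤ m) (h : br x a = (c : ℂ) • a) : a = 0 := by
  have key : ∀ j, a ∈ lcs br N (m + j) := by
    intro j
    induction j with
    | zero => exact ha
    | succ j ih =>
      have h1 := eig_step br hleib hanti N x hx (m + j) a ih
      rw [h, ← sub_smul] at h1
      refine (Submodule.smul_mem_iff _ ?_).1 h1
      intro h0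
      have : ((c : ℂ)) = ((m + j + 1 : ℕ) : ℂ) := by push_cast at h0 ⊢; linear_combination h0
      have := Nat.cast_injective this
      omega
  obtain ⟨k, hk⟩ := hnil
  have hle : ∀ j, lcs br N (k + j) = ⊥ := by
    intro j
    induction j with
    | zero => exact hk
    | succ j ih =>
      rw [eq_bot_iff, ← ih]
      exact lcs_anti br hleib hanti N hN (k + j)
  have := key k
  rw [add_comm, hle] at this
  simpa using this

lemma nil_prod (br : Bil R) (hleib : IsLeibniz br) (hanti : ∀ x y : R, br x y = - br y x)
    (N : Submodule ℂ R) (hN : IsIdeal br N) (r : R) (m : ℕ) (s : ℕ) :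
    ∀ p q : ℕ, p + q = s → ∀ a b : R, a ∈ lcs br N m → b ∈ N →
      ((br r : Module.End ℂ R) ^ p) a ∈ lcs br N (m + 1) →
      ((br r : Module.End ℂ R) ^ q) b ∈ lcs br N 1 →
      ((br r : Module.End ℂ R) ^ s) (br a b) ∈ lcs br N (m + 2) := by
  have hst : ∀ t l, ∀ a ∈ lcs br N l, ((br r : Module.End ℂ R) ^ t) a ∈ lcs br N l := by
    intro t l
    induction t with
    | zero => intro a ha; simpa using ha
    | succ t ih =>
      intro a ha
      rw [pow_succ, Module.End.mul_apply]
      exact ih _ (lcs_stable br hleib hanti N hN r l a ha)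
  induction s with
  | zero =>
    intro p q hpq a b ha hb h1 h2
    obtain rfl : p = 0 := by omega
    exact lcs_br br N (m+1) (by simpa using h1) hb
  | succ s ih =>
    intro p q hpq a b ha hb h1 h2
    rcases p with _ | p
    · exact hst _ _ _ (lcs_br br N (m+1) (by simpa using h1) hb)
    rcases q with _ | q
    · exact hst _ _ _ (lcs_br2 br hleib N m ha (by simpa using h2))
    rw [pow_succ, Module.End.mul_apply, jac_of br hleib hanti, map_add]
    refine Submodule.add_mem _ ?_ ?_
    · refine ih p (q+1) (by omega) _ _ (lcs_stable br hleib hanti N hN r m a ha) hb ?_ h2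
      rwa [pow_succ, Module.End.mul_apply] at h1
    · refine ih (p+1) q (by omega) _ _ ha (lcs_stable br hleib hanti N hN r 0 b hb) h1 ?_
      rwa [pow_succ, Module.End.mul_apply] at h2

lemma nil_step (br : Bil R) (hleib : IsLeibniz br) (hanti : ∀ x y : R, br x y = - br y x)
    (N : Submodule ℂ R) (hN : IsIdeal br N) (r : R)
    (hr : ∃ p : ℕ, ∀ n ∈ N, ((br r : Module.End ℂ R) ^ p) n ∈ lcs br N 1) (m : ℕ) :
    ∃ p : ℕ, ∀ a ∈ lcs br N m, ((br r : Module.End ℂ R) ^ p) a ∈ lcs br N (m + 1) := by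
  induction m with
  | zero => exact hr
  | succ m ih =>
    obtain ⟨p, hp⟩ := ih
    obtain ⟨q, hq⟩ := hr
    refine ⟨p + q, fun a ha => ?_⟩
    refine (Submodule.span_le.2 ?_ : lcs br N (m+1) ≤
      (lcs br N (m+2)).comap ((br r : Module.End ℂ R) ^ (p + q))) ha
    rintro _ ⟨a, ha, b, hb, rfl⟩
    exact nil_prod br hleib hanti N hN r m (p + q) p q rfl a b ha hb (hp a ha) (hq b hb)

lemma nil_all [FiniteDimensional ℂ R]
    (br : Bil R) (hleib : IsLeibniz br) (hanti : ∀ x y : R, br x y = - br y x)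
    (N : Submodule ℂ R) (hN : IsIdeal br N) (hnil : IsNilpotentSub br N)
    (hder : ∀ x y, br x y ∈ N) (r : R)
    (hr : ∃ p : ℕ, ∀ n ∈ N, ((br r : Module.End ℂ R) ^ p) n ∈ lcs br N 1) :
    IsNilpotent (br r : Module.End ℂ R) := by
  have key : ∀ m, ∃ p : ℕ, ∀ n ∈ N, ((br r : Module.End ℂ R) ^ p) n ∈ lcs br N m := by
    intro m
    induction m with
    | zero => exact ⟨0, fun n hn => by rw [pow_zero]; exact hn⟩
    | succ m ih =>
      obtain ⟨p, hp⟩ := ih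
      obtain ⟨q, hq⟩ := nil_step br hleib hanti N hN r hr m
      refine ⟨q + p, fun n hn => ?_⟩
      rw [pow_add, Module.End.mul_apply]
      exact hq _ (hp n hn)
  obtain ⟨k, hk⟩ := hnil
  obtain ⟨p, hp⟩ := key k
  refine ⟨p + 1, ?_⟩
  ext y
  rw [pow_succ, Module.End.mul_apply]
  have := hp _ (hder r y)
  rw [hk] at this
  simpa using this

end Core

section Struct
variable {R : Type u} [AddCommGroup R] [Module ℂ R] [FiniteDimensional ℂ R]

lemma surj_of_ker (N : Submodule ℂ R) (k : ℕ) (hk : finrank ℂ R = finrank ℂ N + k)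
    (β : R →ₗ[ℂ] (Fin k → ℂ)) (h : ∀ s, β s = 0 → s ∈ N) : Function.Surjective β := by
  rw [← LinearMap.range_eq_top]
  apply Submodule.eq_top_of_finrank_eq
  have h1 := β.finrank_range_add_finrank_ker
  have h2 : finrank ℂ (LinearMap.ker β) ≤ finrank ℂ N :=
    Submodule.finrank_mono (fun s hs => h s hs)
  have h3 := Submodule.finrank_le (LinearMap.range β)
  simp only [finrank_fin_fun] at h3 ⊢
  omega

lemma diag_of {V : Type v} [AddCommGroup V] [Module ℂ V] [FiniteDimensional ℂ V] (k : ℕ)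
    (hV : finrank ℂ V = k) (ρ : R →ₗ[ℂ] Module.End ℂ V)
    (hcomm : ∀ x y v, ρ x (ρ y v) = ρ y (ρ x v)) (N : Submodule ℂ R)
    (hk : finrank ℂ R = finrank ℂ N + k)
    (α : Fin k → (R →ₗ[ℂ] ℂ)) (hα : ∀ r, (∀ i, α i r = 0) → r ∈ N)
    (heig : ∀ r μ, Module.End.HasEigenvalue (ρ r) μ ↔ ∃ i, α i r = μ) :
    ∃ (b : Module.Basis (Fin k) ℂ V) (β : R →ₗ[ℂ] (Fin k → ℂ)),
      (∀ s i, ρ s (b i) = β s i • b i) ∧ Function.Surjective β ∧ ∀ s, β s = 0 → s ∈ N := by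
  have hs := surj_of_ker N k hk (LinearMap.pi α) (fun s hs => hα s (fun i => congrFun hs i))
  obtain ⟨r, hr⟩ := hs (fun i => ((i : ℕ) : ℂ))
  have hr' : ∀ i, α i r = ((i : ℕ) : ℂ) := fun i => congrFun hr i
  have hex : ∀ i : Fin k, ∃ v, Module.End.HasEigenvector (ρ r) ((i : ℕ) : ℂ) v := fun i =>
    ((heig r _).2 ⟨i, hr' i⟩).exists_hasEigenvector
  choose v hv using hex
  have hli : LinearIndependent ℂ v := by
    refine Module.End.eigenvectors_linearIndependent' (ρ r) (fun i : Fin k => ((i : ℕ) : ℂ)) ?_ v hv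
    intro i j hij
    exact Fin.ext (Nat.cast_injective hij)
  let b := basisOfLinearIndependentOfCardEqFinrank' v hli (by simp [hV])
  have hb : ∀ i, b i = v i := fun i => by simp [b]
  have hcoord : ∀ j, (b.coord j) ∘ₗ (ρ r) = ((j : ℕ) : ℂ) • b.coord j := by
    intro j
    refine b.ext fun i => ?_
    have : ρ r (b i) = ((i : ℕ) : ℂ) • b i := by rw [hb]; exact (hv i).apply_eq_smul
    simp only [LinearMap.comp_apply, this, map_smul, LinearMap.smul_apply]
    by_cases hij : i = j
    · subst hij; rfl
    · simp [Module.Basis.coord_apply, hij]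
  let β : R →ₗ[ℂ] (Fin k → ℂ) :=
    LinearMap.pi fun i => (b.coord i) ∘ₗ ((LinearMap.applyₗ (b i)) ∘ₗ ρ)
  have hβ : ∀ s i, β s i = b.coord i (ρ s (b i)) := fun s i => rfl
  have hdiag : ∀ s i, ρ s (b i) = β s i • b i := by
    intro s i
    apply b.ext_elem
    intro j
    rw [hβ, map_smul]
    by_cases hij : i = j
    · subst hij; simp
    · have h1 : ρ r (ρ s (b i)) = ((i : ℕ) : ℂ) • ρ s (b i) := by
        rw [hcomm, hb, (hv i).apply_eq_smul, map_smul]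
      have h2 := LinearMap.congr_fun (hcoord j) (ρ s (b i))
      rw [LinearMap.comp_apply, h1, map_smul, LinearMap.smul_apply, ← sub_eq_zero, ← sub_smul,
        smul_eq_zero] at h2
      have h3 : (((i : ℕ) : ℂ) - ((j : ℕ) : ℂ)) ≠ 0 := by
        rw [sub_ne_zero]
        intro h; exact hij (Fin.ext (Nat.cast_injective h))
      have h4 := h2.resolve_left h3
      rw [Module.Basis.coord_apply] at h4
      simp [h4, hij]
  have hker : ∀ s, β s = 0 → s ∈ N := by
    intro s hs
    have h0 : ρ s = 0 := b.ext fun i => by simp [hdiag, hs]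
    refine hα s fun i => ?_
    have h1 := (heig s (α i s)).2 ⟨i, rfl⟩
    obtain ⟨w, hw⟩ := h1.exists_hasEigenvector
    have h2 := hw.apply_eq_smul
    rw [h0, LinearMap.zero_apply, eq_comm, smul_eq_zero] at h2
    exact h2.resolve_right hw.2
  exact ⟨b, β, hdiag, surj_of_ker N k hk β hker, hker⟩

lemma struct_of (br : Bil R) (hleib : IsLeibniz br) (hanti : ∀ x y : R, br x y = - br y x)
    (hsolv : IsSolvableSub br (⊤ : Submodule ℂ R))
    (N Q : Submodule ℂ R) (hN : IsNilradical br N) (hQ : IsCompl N Q)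
    (hdimQ : finrank ℂ Q = dimModSq br N) :
    (∀ x y, br x y ∈ N) ∧ ∃ (k : ℕ) (β c : R →ₗ[ℂ] (Fin k → ℂ)) (g : Fin k → R),
      Function.Surjective β ∧ (∀ s, β s = 0 → s ∈ N) ∧
      (∀ n ∈ N, c n = 0 → n ∈ lcs br N 1) ∧ (∀ n ∈ lcs br N 1, c n = 0) ∧
      (∀ i, g i ∈ N ∧ c (g i) = Pi.single i 1) ∧ ∀ s, ∀ n ∈ N, c (br s n) = β s * c n := by
  obtain ⟨hid, hnil, hmax⟩ := hN
  -- ideals of ad-nilpotent elements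
  have engel : ∀ (m : ℕ) (α : Fin m → (R →ₗ[ℂ] ℂ)), (∀ i x y, α i (br x y) = 0) →
      (∀ r, (∀ i, α i r = 0) → IsNilpotent (br r : Module.End ℂ R)) →
      ∀ r, (∀ i, α i r = 0) → r ∈ N := by
    intro m α h1 h2 r hr
    let I : Submodule ℂ R := ⨅ i, LinearMap.ker (α i)
    have hI : ∀ r, r ∈ I ↔ ∀ i, α i r = 0 := fun r => by simp [I]
    have hII : IsIdeal br I :=
      ⟨le_top, fun x _ y _ => ⟨(hI _).2 fun i => h1 i x y, (hI _).2 fun i => h1 i y x⟩⟩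
    exact hmax I hII (engel_of br hleib hanti I hII fun x hx => h2 x ((hI x).1 hx)) ((hI r).2 hr)
  have hder : ∀ x y, br x y ∈ N := by
    obtain ⟨α, h1, h2⟩ := weights_exist br hleib hanti hsolv _ R rfl br (fun x y v => by
      rw [jac_of br hleib hanti x y v]; abel)
    intro x y
    refine engel _ α h1 (fun r hr => nilp_of_eig _ fun μ hμ => ?_) _ fun i => h1 i x y
    obtain ⟨i, hi⟩ := (h2 r μ).1 hμ
    rw [← hi, hr i]
  refine ⟨hder, ?_⟩
  let P : Submodule ℂ N := Submodule.comap N.subtype (sqr br N)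
  have hP : ∀ n : N, n ∈ P ↔ (n : R) ∈ lcs br N 1 := fun n => Iff.rfl
  let f : R → (N →ₗ[ℂ] N) := fun r => (br r).restrict fun n hn => (hid.2 n hn r trivial).2
  have hf : ∀ r (n : N), ((f r n : N) : R) = br r n := fun r n => rfl
  have hfP : ∀ r, P ≤ P.comap (f r) := fun r n hn =>
    lcs_stable br hleib hanti N hid r 1 n hn
  let ρ : R →ₗ[ℂ] Module.End ℂ (N ⧸ P) :=
    { toFun := fun r => P.mapQ P (f r) (hfP r)
      map_add' := fun x y => by
        ext w
        change P.mkQ (f (x + y) w) = P.mkQ (f x w) + P.mkQ (f y w)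
        rw [← map_add]; congr 1; ext; simp [hf]
      map_smul' := fun t x => by
        ext w
        change P.mkQ (f (t • x) w) = t • P.mkQ (f x w)
        rw [← map_smul]; congr 1; ext; simp [hf] }
  have hρa : ∀ r n, ρ r (P.mkQ n) = P.mkQ (f r n) := fun r n => rfl
  have hρ : ∀ x y v, ρ (br x y) v = ρ x (ρ y v) - ρ y (ρ x v) := by
    intro x y v
    obtain ⟨n, rfl⟩ := P.mkQ_surjective v
    simp only [hρa]
    rw [← map_sub]
    congr 1
    ext
    rw [AddSubgroupClass.coe_sub]
    simp only [hf]
    rw [jac_of br hleib hanti x y n]; abel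
  have hρN : ∀ n ∈ N, ρ n = 0 := by
    intro n hn
    refine LinearMap.ext fun v => ?_
    obtain ⟨m, rfl⟩ := P.mkQ_surjective v
    rw [hρa, LinearMap.zero_apply, Submodule.mkQ_apply, Submodule.Quotient.mk_eq_zero, hP, hf]
    exact lcs_br br N 0 hn m.2
  have hcomm : ∀ x y v, ρ x (ρ y v) = ρ y (ρ x v) := by
    intro x y v
    have := hρ x y v
    rw [hρN _ (hder x y), LinearMap.zero_apply, eq_comm, sub_eq_zero] at this
    exact this
  obtain ⟨α, h1, h2⟩ := weights_exist br hleib hanti hsolv _ (N ⧸ P) rfl ρ hρ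
  have hα : ∀ r, (∀ i, α i r = 0) → r ∈ N := by
    refine engel _ α h1 fun r hr => ?_
    refine nil_all br hleib hanti N hid hnil hder r ?_
    obtain ⟨p, hp⟩ : IsNilpotent (ρ r) := nilp_of_eig _ fun μ hμ => by
      obtain ⟨i, hi⟩ := (h2 r μ).1 hμ
      rw [← hi, hr i]
    refine ⟨p, fun n hn => ?_⟩
    have key : ∀ q : ℕ, ∃ hm : ((br r : Module.End ℂ R) ^ q) n ∈ N,
        (ρ r ^ q) (P.mkQ ⟨n, hn⟩) = P.mkQ ⟨((br r : Module.End ℂ R) ^ q) n, hm⟩ := by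
      intro q
      induction q with
      | zero => exact ⟨hn, rfl⟩
      | succ q ih =>
        obtain ⟨hm, ih⟩ := ih
        have e : ((br r : Module.End ℂ R) ^ (q + 1)) n = br r (((br r : Module.End ℂ R) ^ q) n) := by
          rw [pow_succ', Module.End.mul_apply]
        refine ⟨by rw [e]; exact hder _ _, ?_⟩
        rw [pow_succ', Module.End.mul_apply, ih, hρa]
        congr 1
        ext
        rw [hf]
        exact e.symm
    obtain ⟨hm, h⟩ := key p
    rw [hp, LinearMap.zero_apply, eq_comm, Submodule.mkQ_apply,
      Submodule.Quotient.mk_eq_zero] at h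
    exact h
  have hk : finrank ℂ R = finrank ℂ N + finrank ℂ (N ⧸ P) := by
    rw [← Submodule.finrank_add_eq_of_isCompl hQ, hdimQ]; rfl
  obtain ⟨b, β, hb, hsurj, hker⟩ := diag_of _ rfl ρ hcomm N hk α hα h2
  obtain ⟨c, hc⟩ := LinearMap.exists_extend (b.equivFun.toLinearMap ∘ₗ P.mkQ)
  have hc' : ∀ n (hn : n ∈ N), c n = b.equivFun (P.mkQ ⟨n, hn⟩) := fun n hn =>
    LinearMap.congr_fun hc ⟨n, hn⟩
  have hg : ∀ i, ∃ n, n ∈ N ∧ c n = Pi.single i 1 := by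
    intro i
    obtain ⟨n, hn⟩ := P.mkQ_surjective (b i)
    refine ⟨n, n.2, ?_⟩
    rw [hc' n n.2, hn]
    simp [Module.Basis.equivFun_self, funext_iff, Pi.single_apply, Finsupp.single_apply, eq_comm]
  choose g hg using hg
  refine ⟨_, β, c, g, hsurj, hker, ?_, ?_, hg, ?_⟩
  · intro n hn h
    rw [hc' n hn, LinearEquiv.map_eq_zero_iff, Submodule.mkQ_apply,
      Submodule.Quotient.mk_eq_zero] at h
    exact h
  · intro n hn
    rw [hc' n (lcs_le_s13 br hleib hanti N hid 1 hn), LinearEquiv.map_eq_zero_iff, Submodule.mkQ_apply,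
      Submodule.Quotient.mk_eq_zero]
    exact hn
  · intro s n hn
    rw [hc' n hn, hc' _ (hder s n)]
    have : P.mkQ ⟨br s n, hder s n⟩ = ρ s (P.mkQ ⟨n, hn⟩) := rfl
    rw [this]
    generalize P.mkQ ⟨n, hn⟩ = w
    have h3 : ∀ i, b.coord i ∘ₗ ρ s = β s i • b.coord i := by
      intro i
      refine b.ext fun j => ?_
      simp only [LinearMap.comp_apply, hb, map_smul, LinearMap.smul_apply]
      by_cases hij : j = i
      · subst hij; rfl
      · simp [Module.Basis.coord_apply, hij]
    ext i
    exact LinearMap.congr_fun (h3 i) w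

end Struct

lemma surj_on {R : Type u} [AddCommGroup R] [Module ℂ R] [FiniteDimensional ℂ R]
    (T : R →ₗ[ℂ] R) (N : Submodule ℂ R) (hst : ∀ n ∈ N, T n ∈ N)
    (hinj : ∀ n ∈ N, T n = 0 → n = 0) : ∀ n ∈ N, ∃ m ∈ N, T m = n := by
  intro n hn
  have h1 : Function.Injective (T.restrict hst) := by
    rw [← LinearMap.ker_eq_bot, LinearMap.ker_eq_bot']
    intro m hm
    exact Subtype.ext (hinj m m.2 (congrArg Subtype.val hm))
  obtain ⟨m, hm⟩ := LinearMap.surjective_of_injective h1 ⟨n, hn⟩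
  exact ⟨m, m.2, congrArg Subtype.val hm⟩

lemma core_of {R : Type u} [AddCommGroup R] [Module ℂ R] [FiniteDimensional ℂ R]
    (br : Bil R) (hleib : IsLeibniz br) (hanti : ∀ x y : R, br x y = - br y x)
    (N : Submodule ℂ R) (hN : IsIdeal br N) (hnil : IsNilpotentSub br N)
    (hder : ∀ x y, br x y ∈ N) (k : ℕ) (β c : R →ₗ[ℂ] (Fin k → ℂ)) (g : Fin k → R)
    (hsurj : Function.Surjective β) (hker : ∀ s, β s = 0 → s ∈ N)
    (hc1 : ∀ n ∈ N, c n = 0 → n ∈ lcs br N 1) (hc0 : ∀ n ∈ lcs br N 1, c n = 0)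
    (hg : ∀ i, g i ∈ N ∧ c (g i) = Pi.single i 1)
    (hcβ : ∀ s, ∀ n ∈ N, c (br s n) = β s * c n) :
    (∀ z : R, (∀ y, br z y = 0) → z = 0) ∧
    (∀ d : R →ₗ[ℂ] R, (∀ x y : R, d (br x y) = br (d x) y + br x (d y)) →
      ∃ a : R, ∀ y : R, d y = br y a) := by
  have jac := jac_of br hleib hanti
  have hself : ∀ y, br y y = 0 := fun y => by
    have h2 : (2 : ℂ) • br y y = 0 := by
      rw [two_smul]; nth_rewrite 1 [hanti y y]; simp
    simpa using h2
  have hβN : ∀ n ∈ N, β n = 0 := by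
    intro n hn
    ext i
    have h := hcβ n (g i) (hg i).1
    rw [hc0 _ (lcs_br br N 0 hn (hg i).1), (hg i).2] at h
    have := congrFun h i
    simpa using this.symm
  obtain ⟨x, hx⟩ := hsurj 1
  have hxs : ∀ n ∈ N, br x n - n ∈ lcs br N 1 := by
    intro n hn
    refine hc1 _ (Submodule.sub_mem _ (hder _ _) hn) ?_
    rw [map_sub, hcβ x n hn, hx, one_mul, sub_self]
  have F1 : ∀ n ∈ N, br x n = 0 → n = 0 := fun n hn h =>
    eig_zero br hleib hanti N hnil hN x hxs 0 n hn 0 le_rfl (by simpa using h)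
  have F4 : ∀ n ∈ lcs br N 1, br x n = n → n = 0 := fun n hn h =>
    eig_zero br hleib hanti N hnil hN x hxs 1 n hn 1 le_rfl (by simpa using h)
  have S1 := surj_on (br x) N (fun n _ => hder x n) F1
  have S2 := surj_on (br x - LinearMap.id) (lcs br N 1)
    (fun n hn => Submodule.sub_mem _ (lcs_stable br hleib hanti N hN x 1 n hn) hn)
    (fun n hn h => F4 n hn (sub_eq_zero.1 h))
  have F2 : ∀ r, ∃ n ∈ N, br x (r - n) = 0 := by
    intro r
    obtain ⟨n, hn, h⟩ := S1 (br x r) (hder x r)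
    exact ⟨n, hn, by rw [map_sub, h, sub_self]⟩
  have F3 : ∀ h h', br x h = 0 → br x h' = 0 → br h h' = 0 := by
    intro h h' h1 h2
    refine F1 _ (hder _ _) ?_
    rw [jac, h1, h2]; simp
  have FH : ∀ t : Fin k → ℂ, ∃ h, br x h = 0 ∧ β h = t := by
    intro t
    obtain ⟨r, hr⟩ := hsurj t
    obtain ⟨n, hn, h⟩ := F2 r
    exact ⟨r - n, h, by rw [map_sub, hβN n hn, sub_zero, hr]⟩
  have hHβ : ∀ h, br x h = 0 → β h = 0 → h = 0 := fun h h1 h2 => F1 h (hker h h2) h1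
  have F5 : ∀ n ∈ N, ∃ e ∈ N, br x e = e ∧ n - e ∈ lcs br N 1 := by
    intro n hn
    obtain ⟨w, hw, h⟩ := S2 _ (hxs n hn)
    refine ⟨n - w, Submodule.sub_mem _ hn (lcs_le_s13 br hleib hanti N hN 1 hw), ?_, by simpa using hw⟩
    simp only [LinearMap.sub_apply, LinearMap.id_apply] at h
    rw [map_sub, sub_eq_sub_iff_sub_eq_sub, h]
  have hee : ∀ i, ∃ e ∈ N, br x e = e ∧ c e = Pi.single i 1 := by
    intro i
    obtain ⟨e, he, h1, h2⟩ := F5 (g i) (hg i).1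
    refine ⟨e, he, h1, ?_⟩
    have := hc0 _ h2
    rw [map_sub, sub_eq_zero] at this
    rw [← this, (hg i).2]
  choose e heN hex hec using hee
  -- eigenvectors of `ad x` with equal coordinates coincide
  have F6 : ∀ n ∈ N, ∀ m ∈ N, br x n = n → br x m = m → c n = c m → n = m := by
    intro n hn m hm h1 h2 h3
    have := F4 (n - m) (hc1 _ (Submodule.sub_mem _ hn hm) (by rw [map_sub, h3, sub_self]))
      (by rw [map_sub, h1, h2])
    exact sub_eq_zero.1 this
  have hhe : ∀ h, br x h = 0 → ∀ i, br h (e i) = β h i • e i := by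
    intro h hh i
    refine F6 _ (hder _ _) _ (Submodule.smul_mem _ _ (heN i)) ?_ ?_ ?_
    · rw [jac, hh, hex]; simp
    · rw [map_smul, hex]
    · rw [hcβ h _ (heN i), map_smul, hec]
      ext j
      by_cases hij : i = j
      · subst hij; simp
      · simp [Pi.single_apply, Ne.symm hij]
  have D1 : ∀ d : R →ₗ[ℂ] R, (∀ x y : R, d (br x y) = br (d x) y + br x (d y)) →
      br x (d x) = 0 → ∃ a : R, ∀ y : R, d y = br y a := by
    intro d hd hdx
    have hdH : ∀ h, br x h = 0 → br x (d h) = 0 := by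
      intro h hh
      have := hd x h
      rw [hh, map_zero, F3 _ _ hdx hh, zero_add] at this
      exact this.symm
    have hd0 : ∀ h, br x h = 0 → d h = 0 := by
      intro h hh
      refine hHβ _ (hdH h hh) ?_
      ext i
      have h1 := hd h (e i)
      rw [hhe h hh, map_smul, hhe _ (hdH h hh)] at h1
      obtain ⟨n, hn, hn2⟩ := F2 (d (e i))
      obtain ⟨h0, hh0⟩ : ∃ h0, h0 = d (e i) - n := ⟨_, rfl⟩
      have h2 : d (e i) = h0 + n := by rw [hh0]; abel
      rw [← hh0] at hn2
      rw [h2, map_add, F3 _ _ hh hn2, zero_add] at h1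
      have h3 : β h i • h0 = 0 := by
        refine F1 _ ?_ (by rw [map_smul, hn2, smul_zero])
        have : β h i • h0 = β (d h) i • e i + br h n - β h i • n := by
          rw [← h1]; module
        rw [this]
        exact Submodule.sub_mem _ (Submodule.add_mem _ (Submodule.smul_mem _ _ (heN i)) (hder _ _))
          (Submodule.smul_mem _ _ hn)
      rw [smul_add, h3, zero_add] at h1
      have h4 := congrFun (congrArg c h1) i
      rw [map_smul, map_add, map_smul, hcβ h n hn, hec] at h4
      simpa using h4
    have hde : ∀ i, br x (d (e i)) = d (e i) := by
      intro i
      have h1 := hd x (e i)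
      rw [hex, hd0 x (hself x)] at h1
      simpa using h1.symm
    have hdN : ∀ i, d (e i) ∈ N := fun i => by rw [← hde i]; exact hder _ _
    have hlam : ∀ i, d (e i) = c (d (e i)) i • e i := by
      intro i
      refine F6 _ (hdN i) _ (Submodule.smul_mem _ _ (heN i)) (hde i) (by rw [map_smul, hex]) ?_
      rw [map_smul, hec]
      ext j
      by_cases hij : j = i
      · subst hij; simp
      · obtain ⟨h, hh, hβ⟩ := FH (Pi.single i 1)
        have h1 := hd h (e i)
        rw [hd0 h hh, hhe h hh, map_smul, hβ] at h1
        have h2 := congrFun (congrArg c h1) j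
        rw [map_zero, LinearMap.zero_apply, zero_add, hcβ h _ (hdN i), hβ] at h2
        simpa [hij] using h2
    obtain ⟨h, hh, hβ⟩ := FH (fun i => - c (d (e i)) i)
    refine ⟨h, ?_⟩
    let S : Submodule ℂ R := LinearMap.ker (d + br h)
    have hS : ∀ y, y ∈ S ↔ d y = br y h := by
      intro y
      rw [LinearMap.mem_ker, LinearMap.add_apply, hanti h y, ← sub_eq_add_neg, sub_eq_zero]
    have hSe : ∀ i, e i ∈ S := by
      intro i
      rw [hS, hanti, hhe h hh, hβ, hlam i]
      simp [hec]
    have hNS : N ≤ S := by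
      refine gen_of br hleib hanti N hN hnil S ?_ ?_
      · intro a ha b hb
        rw [LinearMap.mem_ker, LinearMap.add_apply] at *
        rw [hd, jac]
        have : br (d a + br h a) b + br a (d b + br h b) = 0 := by rw [ha, hb]; simp
        rw [← this]
        simp only [map_add, LinearMap.add_apply]
        abel
      · intro n hn
        have hsum : ∑ i, c n i • e i ∈ N :=
          Submodule.sum_mem _ fun i _ => Submodule.smul_mem _ _ (heN i)
        refine ⟨∑ i, c n i • e i, Submodule.sum_mem _ fun i _ => Submodule.smul_mem _ _ (hSe i),
          hsum, hc1 _ (Submodule.sub_mem _ hn hsum) ?_⟩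
        rw [map_sub, map_sum]
        ext j
        simp [hec, Pi.single_apply]
    intro y
    obtain ⟨n, hn, hy⟩ := F2 y
    have h1 : d (y - n) = br (y - n) h := by rw [hd0 _ hy, F3 _ _ hy hh]
    have h2 := (hS n).1 (hNS hn)
    simp only [map_sub, LinearMap.sub_apply, h2] at h1
    exact sub_left_injective h1
  refine ⟨?_, ?_⟩
  · intro z hz
    have hzx : br x z = 0 := by rw [hanti, hz, neg_zero]
    refine hHβ z hzx ?_
    ext i
    have h1 := congrFun (congrArg c (hhe z hzx i)) i
    rw [hz, map_smul, hec] at h1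
    simpa using h1.symm
  · intro d hd
    obtain ⟨n, hn, h⟩ := F2 (d x)
    obtain ⟨a, -, hax⟩ := S1 n hn
    obtain ⟨a', ha'⟩ := D1 (d + br a) (by
      intro u v
      simp only [LinearMap.add_apply, map_add, hd, jac a u v]
      abel) (by
      rw [LinearMap.add_apply, hanti a x, hax, ← sub_eq_add_neg, h])
    refine ⟨a + a', fun y => ?_⟩
    rw [map_add, ← ha' y, LinearMap.add_apply, hanti a y]
    abel

/-- Theorem 2.4, the Lie case. A solvable Lie algebra `R = N ⊕ Q` with
nilradical `N` and `dim Q = dim (N/[N,N])` is complete: trivial center and every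
derivation is `ad x : y ↦ [y, x]` for some `x`. A Lie algebra is formalized as a Leibniz
algebra with antisymmetric bracket. -/
theorem stmt13 {L : Type u} [AddCommGroup L] [Module ℂ L] [FiniteDimensional ℂ L]
    (br : Bil L) (hleib : IsLeibniz br) (hanti : ∀ x y : L, br x y = - br y x)
    (hsolv : IsSolvableSub br (⊤ : Submodule ℂ L))
    (N Q : Submodule ℂ L) (hN : IsNilradical br N) (hQ : IsCompl N Q)
    (hdimQ : finrank ℂ Q = dimModSq br N) :
    ({c : L | ∀ y : L, br c y = 0 ∧ br y c = 0} = {(0 : L)}) ∧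
    (∀ d : L →ₗ[ℂ] L, (∀ x y : L, d (br x y) = br (d x) y + br x (d y)) →
      ∃ a : L, ∀ y : L, d y = br y a) := by
  obtain ⟨hder, k, β, c, g, h1, h2, h3, h4, h5, h6⟩ :=
    struct_of br hleib hanti hsolv N Q hN hQ hdimQ
  obtain ⟨hz, hd⟩ := core_of br hleib hanti N hN.1 hN.2.1 hder k β c g h1 h2 h3 h4 h5 h6
  refine ⟨?_, hd⟩
  ext z
  simp only [Set.mem_setOf_eq, Set.mem_singleton_iff]
  constructor
  · intro h; exact hz z fun y => (h y).1
  · rintro rfl y; simp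
end
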